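/- arXiv:2305.17439 — 9 statements merged into one kernel-verified Lean document; each statement's English description precedes it below -/
import Mathlib

section
/- Let U ⊆ ℝⁿ be open and let D ⊆ U × ℝⁿ be a closed distribution. Then there exists a countable ordinal α such that the iterated derived distribution D^(α) is perfect, i.e. D^(α+1) = D^(α). -/
open Set

/-- The tangent distribution `TS ⊆ U × ℝⁿ` of a set `S ⊆ U`: its fiber over `p ∈ U` consists of
the vectors annihilated by the differentials at `p` of all smooth functions on `U` vanishing
identically on `S`. -/
def tangentDist (n : ℕ) (U S : Set (Fin n → ℝ)) : Set ((Fin n → ℝ) × (Fin n → ℝ)) :=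
  {pv | pv.1 ∈ U ∧ ∀ f : (Fin n → ℝ) → ℝ, ContDiffOn ℝ (⊤ : ℕ∞) f U →
    (∀ x ∈ S, f x = 0) → fderiv ℝ f pv.1 pv.2 = 0}

/-- The support of a distribution: the set of points with nonzero fiber. -/
def distSupport (n : ℕ) (D : Set ((Fin n → ℝ) × (Fin n → ℝ))) : Set (Fin n → ℝ) :=
  {p | {v | (p, v) ∈ D} ≠ ({0} : Set (Fin n → ℝ))}

/-- The derived distribution `D' = D ∩ T S_D`, relative to smooth functions on `U`. -/
def derivedDist (n : ℕ) (U : Set (Fin n → ℝ)) (D : Set ((Fin n → ℝ) × (Fin n → ℝ))) :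
    Set ((Fin n → ℝ) × (Fin n → ℝ)) :=
  D ∩ tangentDist n U (distSupport n D)

/-- The transfinite iteration of the derived-distribution operation:
`D^(0) = D`, `D^(α+1) = (D^(α))'`, and `D^(l) = ⋂_{β < l} D^(β)` at limit ordinals `l`. -/
noncomputable def iterDerived (n : ℕ) (U : Set (Fin n → ℝ))
    (D : Set ((Fin n → ℝ) × (Fin n → ℝ))) (α : Ordinal) :
    Set ((Fin n → ℝ) × (Fin n → ℝ)) :=
  Ordinal.limitRecOn α D (fun _ ih => derivedDist n U ih)
    (fun o _ ih => ⋂ (β : Ordinal) (h : β < o), ih β h)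

section IterDerived

universe u

variable {n : ℕ} {U : Set (Fin n → ℝ)} {D : Set ((Fin n → ℝ) × (Fin n → ℝ))}

theorem iterDerived_zero : iterDerived n U D (0 : Ordinal.{u}) = D :=
  Ordinal.limitRecOn_zero _ _ _

theorem iterDerived_add_one (α : Ordinal.{u}) :
    iterDerived n U D (α + 1) = derivedDist n U (iterDerived n U D α) :=
  Ordinal.limitRecOn_add_one _ _ _ _

theorem iterDerived_of_isSuccLimit {α : Ordinal.{u}} (hα : Order.IsSuccLimit α) :
    iterDerived n U D α = ⋂ (β : Ordinal.{u}) (_ : β < α), iterDerived n U D β :=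
  Ordinal.limitRecOn_limit _ _ _ _ hα

theorem antitone_iterDerived : Antitone (iterDerived.{u} n U D) := by
  intro α β
  induction β using Ordinal.limitRecOn with
  | zero => intro h; rw [nonpos_iff_eq_zero.mp h]
  | add_one β ih =>
    intro h
    rcases h.lt_or_eq with h | rfl
    · rw [iterDerived_add_one]
      exact inter_subset_left.trans (ih (Order.lt_add_one_iff.mp h))
    · exact le_rfl
  | limit β hβ ih =>
    intro h
    rcases h.lt_or_eq with h | rfl
    · rw [iterDerived_of_isSuccLimit hβ]
      exact iInter₂_subset α h
    · exact le_rfl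

/-- The tangent distribution of any set is closed in `U × ℝⁿ`. -/
theorem mem_tangentDist_of_mem_closure (hU : IsOpen U) {S : Set (Fin n → ℝ)}
    {q : (Fin n → ℝ) × (Fin n → ℝ)} (hq : q ∈ closure (tangentDist n U S)) (hqU : q.1 ∈ U) :
    q ∈ tangentDist n U S := by
  refine ⟨hqU, fun f hf hfS => ?_⟩
  have hfd : ContinuousAt (fderiv ℝ f) q.1 :=
    (hf.continuousOn_fderiv_of_isOpen hU (by simp)).continuousAt (hU.mem_nhds hqU)
  have hg : ContinuousAt (fun p : (Fin n → ℝ) × (Fin n → ℝ) => fderiv ℝ f p.1 p.2) q :=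
    (hfd.comp continuousAt_fst).clm_apply continuousAt_snd
  by_contra hne
  obtain ⟨p, hp, hpT⟩ :=
    ((mem_closure_iff_frequently.mp hq).and_eventually (hg.eventually_ne hne)).exists
  exact hpT (hp.2 f hf hfS)

/-- The iterated derived distributions of a closed distribution are closed in `U × ℝⁿ`. -/
theorem mem_iterDerived_of_mem_closure (hU : IsOpen U)
    (hclosed : ∀ q ∈ closure D, q.1 ∈ U → q ∈ D) (α : Ordinal.{u}) :
    ∀ q ∈ closure (iterDerived n U D α), q.1 ∈ U → q ∈ iterDerived n U D α := by
  induction α using Ordinal.limitRecOn with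
  | zero => simpa only [iterDerived_zero] using hclosed
  | add_one α ih =>
    intro q hq hqU
    rw [iterDerived_add_one] at hq ⊢
    exact ⟨ih q (closure_mono inter_subset_left hq) hqU,
      mem_tangentDist_of_mem_closure hU (closure_mono inter_subset_right hq) hqU⟩
  | limit α hα ih =>
    intro q hq hqU
    have hsub {β : Ordinal.{u}} (hβ : β < α) : iterDerived n U D α ⊆ iterDerived n U D β :=
      antitone_iterDerived hβ.le
    rw [iterDerived_of_isSuccLimit hα]
    exact mem_iInter₂.mpr fun β hβ => ih β hβ q (closure_mono (hsub hβ) hq) hqU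

end IterDerived

open Cardinal Ordinal in
/-- A decreasing transfinite sequence of relatively closed subsets of an open subset of a
second-countable space stabilizes for one step at some countable ordinal. -/
theorem exists_lt_omega_one_add_one_eq_of_antitone {X : Type*} [TopologicalSpace X]
    [SecondCountableTopology X] {V : Set X} {F : Ordinal → Set X} (hF : Antitone F)
    (hFV : F 0 ⊆ V) (hclosed : ∀ α, ∀ x ∈ closure (F α), x ∈ V → x ∈ F α) :
    ∃ α < ω₁, F (α + 1) = F α := by
  obtain ⟨B, hBc, -, hB⟩ := TopologicalSpace.exists_countable_basis X
  have := hBc.to_subtype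
  have hmin (b : B) : ∃ α < ω₁, ∀ β < ω₁, Disjoint (b : Set X) (F β) → Disjoint (b : Set X) (F α) ∧
      α ≤ β := by
    by_cases h : ∃ β < ω₁, Disjoint (b : Set X) (F β)
    · exact ⟨sInf {β | β < ω₁ ∧ Disjoint (b : Set X) (F β)}, (csInf_mem h).1,
        fun β hβ hd => ⟨(csInf_mem h).2, csInf_le' ⟨hβ, hd⟩⟩⟩
    · exact ⟨0, omega_pos 1, fun β hβ hd => (h ⟨β, hβ, hd⟩).elim⟩
  choose a ha hmin using hmin
  have hsup : ⨆ b, a b < ω₁ := iSup_lt_omega_one ha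
  refine ⟨⨆ b, a b, hsup, (hF (le_add_of_nonneg_right zero_le_one)).antisymm fun x hx => ?_⟩
  by_contra hx'
  have hxc : x ∉ closure (F ((⨆ b, a b) + 1)) := fun h =>
    hx' (hclosed _ x h (hFV (hF zero_le hx)))
  obtain ⟨b, hb, hxb, hbc⟩ := hB.exists_subset_of_mem_open hxc isClosed_closure.isOpen_compl
  have hd : Disjoint b (F ((⨆ b, a b) + 1)) :=
    (Set.disjoint_left.mpr hbc).mono_right subset_closure
  have hda := (hmin ⟨b, hb⟩ _ ((isSuccLimit_omega 1).add_one_lt hsup) hd).1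
  exact Set.disjoint_left.mp hda hxb
    (hF (le_ciSup (Ordinal.bddAbove_of_small) (⟨b, hb⟩ : B)) hx)

/-- Let `U ⊆ ℝⁿ` be open and let `D ⊆ U × ℝⁿ` be a closed distribution
(each fiber over a point of `U` is a linear subspace, and `D` is closed in `U × ℝⁿ`).
Then there exists a countable ordinal `α` such that `D^(α)` is perfect, i.e.
`D^(α+1) = D^(α)`. -/
theorem exists_countable_ordinal_iterDerived_perfect
    (n : ℕ) (U : Set (Fin n → ℝ)) (hU : IsOpen U)
    (D : Set ((Fin n → ℝ) × (Fin n → ℝ)))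
    (hDU : D ⊆ U ×ˢ univ)
    (hlin : ∀ p ∈ U, ∃ W : Submodule ℝ (Fin n → ℝ),
      {v | (p, v) ∈ D} = (W : Set (Fin n → ℝ)))
    (hclosed : ∀ q ∈ closure D, q.1 ∈ U → q ∈ D) :
    ∃ α : Ordinal, α.card ≤ Cardinal.aleph0 ∧
      iterDerived n U D (α + 1) = iterDerived n U D α := by
  obtain ⟨α, hα, h⟩ := exists_lt_omega_one_add_one_eq_of_antitone
    (V := U ×ˢ univ) (antitone_iterDerived (n := n) (U := U) (D := D))
    (by rwa [iterDerived_zero])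
    (fun α q hq hqV => mem_iterDerived_of_mem_closure hU hclosed α q hq hqV.1)
  exact ⟨α, by rwa [Cardinal.card_le_iff, Cardinal.succ_aleph0, Cardinal.ord_aleph], h⟩
end

section
/- Let M be a topological space and let D ⊆ M × ℝⁿ be a closed subset such that each fiber D_p = {v ∈ ℝⁿ : (p,v) ∈ D} is a linear subspace of ℝⁿ. Then for every k, the set {p ∈ M : dim D_p ≥ k} is closed in M; in particular the function p ↦ dim D_p is upper semicontinuous and the support S_D = {p ∈ M : D_p ≠ {0}} is closed in M. -/
open Set

theorem isClosed_setOf_orthonormal {ι E : Type*} [Fintype ι]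
    [NormedAddCommGroup E] [InnerProductSpace ℝ E] :
    IsClosed {f : ι → E | Orthonormal ℝ f} := by
  classical
  simp only [orthonormal_iff_ite, ofPred_forall]
  exact isClosed_iInter fun i ↦ isClosed_iInter fun j ↦
    isClosed_eq (by fun_prop) continuous_const

theorem isCompact_setOf_orthonormal {ι E : Type*} [Fintype ι]
    [NormedAddCommGroup E] [InnerProductSpace ℝ E] [FiniteDimensional ℝ E] :
    IsCompact {f : ι → E | Orthonormal ℝ f} := by
  have : ProperSpace E := FiniteDimensional.proper ℝ E
  refine (isCompact_closedBall (0 : ι → E) 1).of_isClosed_subset isClosed_setOf_orthonormal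
    fun f hf ↦ ?_
  rw [mem_closedBall_zero_iff, pi_norm_le_iff_of_nonneg zero_le_one]
  exact fun i ↦ (hf.1 i).le

theorem Submodule.le_finrank_iff_exists_orthonormal {E : Type*}
    [NormedAddCommGroup E] [InnerProductSpace ℝ E] [FiniteDimensional ℝ E]
    (W : Submodule ℝ E) (k : ℕ) :
    k ≤ Module.finrank ℝ W ↔ ∃ f : Fin k → E, Orthonormal ℝ f ∧ ∀ i, f i ∈ W := by
  constructor
  · intro h
    refine ⟨fun i ↦ stdOrthonormalBasis ℝ W (Fin.castLE h i), ?_, fun i ↦ Subtype.property _⟩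
    exact ((stdOrthonormalBasis ℝ W).orthonormal.comp _ (Fin.castLE_injective h)).comp_linearIsometry
      W.subtypeₗᵢ
  · rintro ⟨f, hf, hfW⟩
    have hli : LinearIndependent ℝ fun i ↦ (⟨f i, hfW i⟩ : W) :=
      LinearIndependent.of_comp W.subtype hf.linearIndependent
    simpa using hli.fintype_card_le_finrank

/-- The dimension of the fibers of a closed family of subspaces of a Euclidean space is upper
semicontinuous: orthonormal frames range over a compact set. -/
theorem isClosed_setOf_le_finrank {M E : Type*} [TopologicalSpace M]
    [NormedAddCommGroup E] [InnerProductSpace ℝ E] [FiniteDimensional ℝ E]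
    (W : M → Submodule ℝ E) (hW : IsClosed {x : M × E | x.2 ∈ W x.1}) (k : ℕ) :
    IsClosed {p | k ≤ Module.finrank ℝ (W p)} := by
  let K := {f : Fin k → E | Orthonormal ℝ f}
  have : CompactSpace K := isCompact_iff_compactSpace.1 isCompact_setOf_orthonormal
  have hC : IsClosed {x : M × K | ∀ i, x.2.1 i ∈ W x.1} := by
    simp only [ofPred_forall]
    refine isClosed_iInter fun i ↦ ?_
    have hc : Continuous fun x : M × K ↦ (x.1, x.2.1 i) :=
      continuous_fst.prodMk ((continuous_apply i).comp (continuous_subtype_val.comp continuous_snd))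
    exact hW.preimage hc
  convert isClosedMap_fst_of_compactSpace _ hC using 1
  ext p
  simp [K, Submodule.le_finrank_iff_exists_orthonormal]



/-- Let `M` be a topological space and let `D ⊆ M × ℝⁿ` be a closed subset
whose fibers `D_p = {v : (p, v) ∈ D}` are linear subspaces of `ℝⁿ`. Then for every `k` the
set `{p : dim D_p ≥ k}` is closed in `M` (i.e. `p ↦ dim D_p` is upper semicontinuous), and
the support `S_D = {p : D_p ≠ {0}}` is closed in `M`. -/
theorem closed_distribution_dim_usc_and_support_closed
    {M : Type*} [TopologicalSpace M] (n : ℕ)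
    (D : Set (M × (Fin n → ℝ)))
    (hclosed : IsClosed D)
    (hlin : ∀ p : M, ∃ W : Submodule ℝ (Fin n → ℝ),
      {v | (p, v) ∈ D} = (W : Set (Fin n → ℝ))) :
    (∀ k : ℕ, IsClosed {p : M | k ≤ Set.finrank ℝ {v | (p, v) ∈ D}}) ∧
      IsClosed {p : M | {v | (p, v) ∈ D} ≠ ({0} : Set (Fin n → ℝ))} := by
  choose W hW using hlin
  have hmem (p : M) (v : Fin n → ℝ) : v ∈ W p ↔ (p, v) ∈ D := (Set.ext_iff.1 (hW p) v).symm
  have key (k : ℕ) : IsClosed {p : M | k ≤ Module.finrank ℝ (W p)} := by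
    let e := EuclideanSpace.equiv (Fin n) ℝ
    have hD : IsClosed {x : M × EuclideanSpace ℝ (Fin n) |
        x.2 ∈ (W x.1).map e.symm.toLinearEquiv.toLinearMap} := by
      have hc : Continuous fun x : M × EuclideanSpace ℝ (Fin n) ↦ (x.1, e x.2) := by fun_prop
      convert hclosed.preimage hc using 1
      ext x
      simp only [mem_ofPred_eq, mem_preimage, ← hmem]
      exact Submodule.mem_map_equiv (e := e.symm.toLinearEquiv) (W x.1)
    simpa only [LinearEquiv.finrank_map_eq] using isClosed_setOf_le_finrank
      (fun p ↦ (W p).map e.symm.toLinearEquiv.toLinearMap) hD k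
  have hfin (p : M) : Set.finrank ℝ (W p : Set (Fin n → ℝ)) = Module.finrank ℝ (W p) := by
    rw [Set.finrank, Submodule.span_eq]
  simp only [hW, hfin]
  refine ⟨key, ?_⟩
  convert key 1 using 3 with p
  rw [Submodule.one_le_finrank_iff, Ne, Ne, ← Submodule.bot_coe (R := ℝ), SetLike.coe_set_eq]
end

section
/- Let U ⊆ ℝⁿ be open, let D ⊆ U × ℝⁿ be a closed distribution, and let V ⊆ U be open. Then the derived distribution of the restriction D|_V = D ∩ (V × ℝⁿ), computed using smooth functions on V, equals the restriction of the derived distribution: (D|_V)' = D' ∩ (V × ℝⁿ). -/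
open Set

open scoped Topology

/-- A smooth function on an open set `V` agrees near any point of `V` with a globally smooth
function which vanishes wherever the original one does and outside `V`. -/
lemma ContDiffOn.exists_contDiff_eventuallyEq {E : Type*} [NormedAddCommGroup E] [NormedSpace ℝ E]
    [FiniteDimensional ℝ E] {V : Set E} (hV : IsOpen V) {g : E → ℝ}
    (hg : ContDiffOn ℝ (⊤ : ℕ∞) g V) {p : E} (hp : p ∈ V) :
    ∃ f : E → ℝ, ContDiff ℝ (⊤ : ℕ∞) f ∧ f =ᶠ[𝓝 p] g ∧ ∀ x, g x = 0 ∨ x ∉ V → f x = 0 := by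
  obtain ⟨r, hr, hrV⟩ := Metric.nhds_basis_closedBall.mem_iff.1 (hV.mem_nhds hp)
  let χ : ContDiffBump p := ⟨r / 2, r, half_pos hr, half_lt_self hr⟩
  have hχV : tsupport χ ⊆ V := χ.tsupport_eq.trans_subset hrV
  refine ⟨fun x => χ x * g x, contDiff_iff_contDiffAt.2 fun x => ?_, ?_, ?_⟩
  · by_cases hx : x ∈ V
    · exact χ.contDiffAt.mul (hg.contDiffAt (hV.mem_nhds hx))
    · have h0 : (fun x => χ x * g x) =ᶠ[𝓝 x] fun _ => 0 := by
        filter_upwards [notMem_tsupport_iff_eventuallyEq.1 fun h => hx (hχV h)] with y hy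
        simp [hy]
      exact contDiffAt_const.congr_of_eventuallyEq h0
  · filter_upwards [χ.eventuallyEq_one] with y hy
    simp [hy]
  · rintro x (hx | hx)
    · simp [hx]
    · simp [image_eq_zero_of_notMem_tsupport fun h => hx (hχV h)]

lemma mem_distSupport_inter_prod_univ {n : ℕ} {V : Set (Fin n → ℝ)}
    {D : Set ((Fin n → ℝ) × (Fin n → ℝ))} {x : Fin n → ℝ} (hx : x ∈ V) :
    x ∈ distSupport n (D ∩ V ×ˢ univ) ↔ x ∈ distSupport n D := by
  simp [distSupport, hx]

/-- Let `U ⊆ ℝⁿ` be open, `D ⊆ U × ℝⁿ` a closed distribution, and `V ⊆ U`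
open. Then the derived distribution of the restriction `D|_V = D ∩ (V × ℝⁿ)`, computed using
smooth functions on `V`, equals the restriction of the derived distribution:
`(D|_V)' = D' ∩ (V × ℝⁿ)`. -/
theorem derivedDist_restrict
    (n : ℕ) (U V : Set (Fin n → ℝ)) (hU : IsOpen U) (hV : IsOpen V) (hVU : V ⊆ U)
    (D : Set ((Fin n → ℝ) × (Fin n → ℝ)))
    (hDU : D ⊆ U ×ˢ univ)
    (hlin : ∀ p ∈ U, ∃ W : Submodule ℝ (Fin n → ℝ),
      {v | (p, v) ∈ D} = (W : Set (Fin n → ℝ)))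
    (hclosed : ∀ q ∈ closure D, q.1 ∈ U → q ∈ D) :
    derivedDist n V (D ∩ V ×ˢ univ) = derivedDist n U D ∩ V ×ˢ univ := by
  ext ⟨p, v⟩
  constructor
  · rintro ⟨⟨hD, hpV⟩, -, h⟩
    have hp : p ∈ V := hpV.1
    refine ⟨⟨hD, hVU hp, fun f hf hf0 => ?_⟩, hpV⟩
    have hfV : EqOn (V.indicator f) f V := fun x hx => indicator_of_mem hx f
    have key := h (V.indicator f) ((hf.mono hVU).congr hfV) fun x hx => by
      by_cases hxV : x ∈ V
      · rw [hfV hxV, hf0 x ((mem_distSupport_inter_prod_univ hxV).1 hx)]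
      · exact indicator_of_notMem hxV f
    rwa [(hfV.eventuallyEq_of_mem (hV.mem_nhds hp)).fderiv_eq] at key
  · rintro ⟨⟨hD, -, h⟩, hpV⟩
    have hp : p ∈ V := hpV.1
    refine ⟨⟨hD, hpV⟩, hp, fun g hg hg0 => ?_⟩
    obtain ⟨f, hf, hfg, hf0⟩ := hg.exists_contDiff_eventuallyEq hV hp
    have key := h f hf.contDiffOn fun x hx => hf0 x <| by
      by_cases hxV : x ∈ V
      · exact Or.inl (hg0 x ((mem_distSupport_inter_prod_univ hxV).2 hx))
      · exact Or.inr hxV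
    rwa [hfg.fderiv_eq] at key
end

section
/- Let D ⊆ ℂⁿ × ℂⁿ be the common zero locus of a set of polynomials in the 2n variables (x₁,…,xₙ,v₁,…,vₙ) over ℂ, and suppose that each fiber D_x = {v ∈ ℂⁿ : (x,v) ∈ D} is a ℂ-linear subspace of ℂⁿ. Then the support S_D = {x ∈ ℂⁿ : D_x ≠ {0}} is the common zero locus of a set of polynomials in the n variables (x₁,…,xₙ) over ℂ. -/
open MvPolynomial

lemma MvPolynomial.map_homogeneousComponent {σ R S : Type*} [CommSemiring R] [CommSemiring S]
    (f : R →+* S) (n : ℕ) (p : MvPolynomial σ R) :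
    map f (homogeneousComponent n p) = homogeneousComponent n (map f p) := by
  ext d
  simp only [coeff_map, coeff_homogeneousComponent]
  split_ifs <;> simp

lemma MvPolynomial.IsHomogeneous.eval_smul_vector {σ R : Type*} [Fintype σ] [CommSemiring R]
    {p : MvPolynomial σ R} {n : ℕ} (hp : p.IsHomogeneous n) (t : R) (v : σ → R) :
    eval (t • v) p = t ^ n * eval v p := by
  rw [eval_eq', eval_eq', Finset.mul_sum]
  refine Finset.sum_congr rfl fun d hd => ?_
  have hdn : ∑ i, d i = n := by
    rw [← Finsupp.degree_eq_sum, Finsupp.degree_apply, hp.degree_eq_sum_deg_support hd]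
  simp only [Pi.smul_apply, smul_eq_mul, mul_pow, Finset.prod_mul_distrib,
    Finset.prod_pow_eq_pow_sum, hdn]
  ring

/-- If a polynomial over an infinite domain vanishes on the line through `v`, then so do its
homogeneous components. -/
lemma MvPolynomial.eval_homogeneousComponent_eq_zero_of_forall_smul {σ R : Type*} [Fintype σ]
    [CommRing R] [IsDomain R] [Infinite R] {p : MvPolynomial σ R} {v : σ → R}
    (h : ∀ t : R, eval (t • v) p = 0) (n : ℕ) :
    eval v (homogeneousComponent n p) = 0 := by
  by_cases hn : p.totalDegree < n
  · rw [homogeneousComponent_eq_zero n p hn, map_zero]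
  let g : Polynomial R := ∑ d ∈ Finset.range (p.totalDegree + 1),
    Polynomial.monomial d (eval v (homogeneousComponent d p))
  have hg : g = 0 := by
    refine Polynomial.zero_of_eval_zero g fun t => ?_
    rw [← h t]
    conv_rhs => rw [← sum_homogeneousComponent p, map_sum]
    simp only [g, Polynomial.eval_finsetSum, Polynomial.eval_monomial]
    refine Finset.sum_congr rfl fun d _ => ?_
    rw [(homogeneousComponent_isHomogeneous d p).eval_smul_vector, mul_comm]
  have hc : g.coeff n = eval v (homogeneousComponent n p) := by
    simp only [g, Polynomial.finsetSum_coeff, Polynomial.coeff_monomial]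
    rw [Finset.sum_ite_eq', if_pos (Finset.mem_range.2 (by lia))]
  rw [← hc, hg, Polynomial.coeff_zero]

/-- The key step of elimination theory: if the specialization at `φ` of an ideal `J` closed under
taking homogeneous components has no nontrivial zero, then `J` contains, for some scalar `a` not
vanishing at `φ`, the multiples by `a` of large powers of all the variables. -/
lemma MvPolynomial.exists_C_mul_X_pow_mem_of_zeroLocus_map_subset {σ A k : Type*} [Finite σ]
    [CommRing A] [Field k] [IsAlgClosed k] {φ : A →+* k} (hφ : Function.Surjective φ)
    {J : Ideal (MvPolynomial σ A)} (hJ : ∀ p ∈ J, ∀ n, homogeneousComponent n p ∈ J)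
    (h : zeroLocus k (J.map (map φ)) ⊆ {0}) :
    ∃ a : A, φ a ≠ 0 ∧ ∃ n : ℕ, ∀ i : σ, C a * X i ^ n ∈ J := by
  have hrad : idealOfVars σ k ≤ (J.map (map φ)).radical := by
    rw [← vanishingIdeal_zeroLocus_eq_radical (K := k), Ideal.span_le]
    rintro _ ⟨i, rfl⟩ v hv
    simp [Set.mem_singleton_iff.1 (h hv)]
  obtain ⟨n, hn⟩ := Ideal.exists_pow_le_of_le_radical_of_fg hrad (idealOfVars_fg σ k)
  have hle : homogeneousSubmodule σ A n ≤
      J.restrictScalars A ⊔ RingHom.ker φ • homogeneousSubmodule σ A n := by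
    intro p hp
    rw [mem_homogeneousSubmodule] at hp
    have hpφ : map φ p ∈ J.map (map φ) := by
      refine hn ((mem_pow_idealOfVars_iff' _ _).2 fun d hd => ?_)
      exact (hp.map φ).coeff_eq_zero hd.ne
    obtain ⟨g, hgJ, hg⟩ :=
      (Ideal.mem_map_iff_of_surjective (map φ) (map_surjective φ hφ)).1 hpφ
    have hq : map φ (p - homogeneousComponent n g) = 0 := by
      rw [map_sub, map_homogeneousComponent, hg, homogeneousComponent_eq_self (hp.map φ), sub_self]
    have hqn : (p - homogeneousComponent n g).IsHomogeneous n :=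
      hp.sub (homogeneousComponent_isHomogeneous n g)
    rw [← add_sub_cancel (homogeneousComponent n g) p]
    refine Submodule.add_mem_sup (hJ g hgJ n) ?_
    rw [(p - homogeneousComponent n g).as_sum]
    refine Submodule.sum_mem _ fun d hd => ?_
    have hdn : d.degree = n := by
      by_contra hne
      exact mem_support_iff.1 hd (hqn.coeff_eq_zero hne)
    rw [← mul_one (coeff d _), ← smul_eq_mul, ← smul_monomial]
    refine Submodule.smul_mem_smul ?_ (isHomogeneous_monomial _ hdn)
    rw [RingHom.mem_ker, ← coeff_map, hq, coeff_zero]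
  obtain ⟨a, ha, haJ⟩ := Submodule.exists_sub_one_mem_and_smul_le_of_fg_of_le_sup
    (homogeneousSubmodule_fg σ A n) le_rfl hle
  refine ⟨a, ?_, n, fun i => ?_⟩
  · rw [RingHom.mem_ker, map_sub, map_one, sub_eq_zero] at ha
    simp [ha]
  · rw [← smul_eq_C_mul]
    exact haJ (Submodule.smul_mem_pointwise_smul _ a _ (isHomogeneous_X_pow i n))

/-- View a polynomial in two families of variables as a polynomial in the second family, with
coefficients polynomials in the first. -/
noncomputable def MvPolynomial.sumToIterated {σ τ R : Type*} [CommSemiring R] :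
    MvPolynomial (τ ⊕ σ) R →+* MvPolynomial σ (MvPolynomial τ R) :=
  eval₂Hom (C.comp C) (Sum.elim (fun i => C (X i)) X)

lemma MvPolynomial.eval_map_sumToIterated {σ τ R : Type*} [CommSemiring R] (x : τ → R) (v : σ → R)
    (p : MvPolynomial (τ ⊕ σ) R) :
    eval v (map (eval x) (sumToIterated p)) = eval (Sum.elim x v) p := by
  have : ((eval v).comp (map (eval x))).comp sumToIterated = eval (Sum.elim x v) := by
    refine ringHom_ext (fun c => ?_) fun i => ?_
    · simp [sumToIterated]
    · cases i <;> simp [sumToIterated]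
  exact congrArg (fun g => g p) this

/-- Let `D ⊆ ℂⁿ × ℂⁿ` be the common zero locus of a set of polynomials in
the `2n` variables `(x, v)` over `ℂ`, with each fiber `D_x` a `ℂ`-linear subspace of `ℂⁿ`.
Then the support `S_D = {x : D_x ≠ {0}}` is the common zero locus of a set of polynomials in
the `n` variables `x`. -/
theorem support_of_algebraic_distribution_is_algebraic
    (n : ℕ) (P : Set (MvPolynomial (Fin n ⊕ Fin n) ℂ))
    (D : Set ((Fin n → ℂ) × (Fin n → ℂ)))
    (hD : D = {xv | ∀ f ∈ P, eval (Sum.elim xv.1 xv.2) f = 0})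
    (hlin : ∀ x : Fin n → ℂ, ∃ W : Submodule ℂ (Fin n → ℂ),
      {v | (x, v) ∈ D} = (W : Set (Fin n → ℂ))) :
    ∃ Q : Set (MvPolynomial (Fin n) ℂ),
      {x : Fin n → ℂ | {v | (x, v) ∈ D} ≠ ({0} : Set (Fin n → ℂ))} =
        {x : Fin n → ℂ | ∀ f ∈ Q, eval x f = 0} := by
  have hzero (x : Fin n → ℂ) : (x, 0) ∈ D := by
    obtain ⟨W, hW⟩ := hlin x
    exact (Set.ext_iff.1 hW 0).2 W.zero_mem
  have hsmul (x v : Fin n → ℂ) (hv : (x, v) ∈ D) (t : ℂ) : (x, t • v) ∈ D := by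
    obtain ⟨W, hW⟩ := hlin x
    exact (Set.ext_iff.1 hW _).2 (W.smul_mem t ((Set.ext_iff.1 hW v).1 hv))
  obtain ⟨J, mem_J⟩ : ∃ J : Ideal (MvPolynomial (Fin n) (MvPolynomial (Fin n) ℂ)),
      ∀ p, p ∈ J ↔ ∀ x v, (x, v) ∈ D → eval v (map (eval x) p) = 0 :=
    ⟨⨅ xv ∈ D, RingHom.ker ((eval xv.2).comp (map (eval xv.1))), fun p => by
      simp [Submodule.mem_iInf, RingHom.mem_ker]⟩
  have hJ (p) (hp : p ∈ J) (m : ℕ) : homogeneousComponent m p ∈ J := by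
    refine (mem_J _).2 fun x v hv => ?_
    rw [map_homogeneousComponent]
    refine eval_homogeneousComponent_eq_zero_of_forall_smul (fun t => ?_) m
    exact (mem_J p).1 hp x (t • v) (hsmul x v hv t)
  refine ⟨{f | ∀ x, {v | (x, v) ∈ D} ≠ {0} → eval x f = 0}, Set.Subset.antisymm
    (fun x hx f hf => hf x hx) fun x hx hx0 => ?_⟩
  have hsub : zeroLocus ℂ (J.map (map (eval x))) ⊆ {0} := by
    intro v hv
    rw [← hx0, Set.mem_ofPred_eq, hD]
    intro f hf
    have hfJ : sumToIterated f ∈ J := (mem_J _).2 fun y w hyw => by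
      rw [hD] at hyw
      exact (eval_map_sumToIterated y w f).trans (hyw f hf)
    rw [← eval_map_sumToIterated]
    simpa [aeval_eq_eval] using hv _ (Ideal.mem_map_of_mem _ hfJ)
  obtain ⟨a, ha, m, haJ⟩ := exists_C_mul_X_pow_mem_of_zeroLocus_map_subset
    (fun c => ⟨C c, eval_C c⟩) hJ hsub
  refine ha (hx a fun y hy => ?_)
  obtain ⟨v, hv, hv0⟩ : ∃ v, (y, v) ∈ D ∧ v ≠ 0 := by
    by_contra! hcon
    exact hy (Set.Subset.antisymm hcon (Set.singleton_subset_iff.2 (hzero y)))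
  obtain ⟨i, hi⟩ := Function.ne_iff.1 hv0
  have := (mem_J _).1 (haJ i) y v hv
  simp only [map_mul, map_C, eval_C, map_pow, map_X, eval_X] at this
  exact (mul_eq_zero.1 this).resolve_right (pow_ne_zero m hi)
end

section
/- Let D ⊆ ℂⁿ × ℂⁿ be the common zero locus of a set of polynomials in (x,v) over ℂ, with each fiber D_x a ℂ-linear subspace of ℂⁿ. Define the algebraic derived sequence D^(0) = D and D^(k+1) = D^(k) ∩ T S_{D^(k)}, where for S ⊆ ℂⁿ the algebraic tangent distribution TS has fibers T_xS = {v ∈ ℂⁿ : Σᵢ (∂f/∂xᵢ)(x) vᵢ = 0 for every polynomial f vanishing identically on S}. Then there exists N ∈ ℕ such that D^(N+1) = D^(N); moreover every D^(k), and in particular the core D^(N), is an algebraic subset of ℂⁿ × ℂⁿ whose fibers are ℂ-linear subspaces. -/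
open MvPolynomial

/-- The algebraic (Zariski) tangent distribution of a set `S ⊆ ℂⁿ`: its fiber over `x`
consists of the vectors `v` with `Σᵢ (∂f/∂xᵢ)(x) vᵢ = 0` for every polynomial `f`
vanishing identically on `S`. -/
def algTangent (n : ℕ) (S : Set (Fin n → ℂ)) : Set ((Fin n → ℂ) × (Fin n → ℂ)) :=
  {xv | ∀ f : MvPolynomial (Fin n) ℂ, (∀ x ∈ S, eval x f = 0) →
    ∑ i, eval xv.1 (pderiv i f) * xv.2 i = 0}

/-- The support of a distribution on `ℂⁿ`: the points with nonzero fiber. -/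
def algSupport (n : ℕ) (D : Set ((Fin n → ℂ) × (Fin n → ℂ))) : Set (Fin n → ℂ) :=
  {x | {v | (x, v) ∈ D} ≠ ({0} : Set (Fin n → ℂ))}

/-- The algebraic derived sequence: `D^(0) = D`, `D^(k+1) = D^(k) ∩ T S_{D^(k)}`. -/
def algDerivedSeq (n : ℕ) (D : Set ((Fin n → ℂ) × (Fin n → ℂ))) :
    ℕ → Set ((Fin n → ℂ) × (Fin n → ℂ))
  | 0 => D
  | k + 1 => algDerivedSeq n D k ∩ algTangent n (algSupport n (algDerivedSeq n D k))

/-- A descending sequence of zero loci of polynomials in finitely many variables stabilizes. -/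
theorem exists_succ_eq_of_zeroLoci {K σ α : Type*} [Field K] [Finite σ] (c : α → σ → K)
    (V : ℕ → Set α) (hV : Antitone V)
    (hQ : ∀ k, ∃ Q : Set (MvPolynomial σ K), V k = {a | ∀ f ∈ Q, eval (c a) f = 0}) :
    ∃ N, V (N + 1) = V N := by
  let I : ℕ →o Ideal (MvPolynomial σ K) :=
    ⟨fun k => ⨅ a ∈ V k, RingHom.ker (eval (c a)), fun i j hij =>
      biInf_mono (hV hij)⟩
  have mem_I (k : ℕ) (f : MvPolynomial σ K) : f ∈ I k ↔ ∀ a ∈ V k, eval (c a) f = 0 := by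
    change f ∈ ⨅ a ∈ V k, RingHom.ker (eval (c a)) ↔ _
    simp [RingHom.mem_ker]
  obtain ⟨N, hN⟩ := monotone_stabilizes_iff_noetherian.mpr
    (inferInstance : IsNoetherian (MvPolynomial σ K) (MvPolynomial σ K)) I
  refine ⟨N, (hV N.le_succ).antisymm fun a ha => ?_⟩
  obtain ⟨Q, hQ⟩ := hQ (N + 1)
  rw [hQ]
  intro f hf
  have hfI : f ∈ I (N + 1) := (mem_I _ _).2 fun b hb => by
    rw [hQ] at hb
    exact hb f hf
  rw [← hN (N + 1) N.le_succ] at hfI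
  exact (mem_I _ _).1 hfI a ha

/-- The algebraic tangent distribution is the zero locus of the differentials of the
polynomials vanishing on `S`. -/
theorem algTangent_eq_zeroLocus (n : ℕ) (S : Set (Fin n → ℂ)) :
    ∃ Q : Set (MvPolynomial (Fin n ⊕ Fin n) ℂ),
      algTangent n S = {xv | ∀ f ∈ Q, eval (Sum.elim xv.1 xv.2) f = 0} := by
  refine ⟨(fun f : MvPolynomial (Fin n) ℂ =>
    ∑ i, rename Sum.inl (pderiv i f) * X (Sum.inr i)) '' {f | ∀ x ∈ S, eval x f = 0}, ?_⟩
  ext xv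
  simp [algTangent, eval_rename]

/-- The fibers of the algebraic tangent distribution are linear subspaces. -/
theorem algTangent_fiber_submodule (n : ℕ) (S : Set (Fin n → ℂ)) (x : Fin n → ℂ) :
    ∃ W : Submodule ℂ (Fin n → ℂ), {v | (x, v) ∈ algTangent n S} = (W : Set (Fin n → ℂ)) := by
  refine ⟨{ carrier := {v | (x, v) ∈ algTangent n S}, add_mem' := ?_, zero_mem' := ?_,
            smul_mem' := ?_ }, rfl⟩
  · intro a b ha hb f hf
    simp [mul_add, Finset.sum_add_distrib, ha f hf, hb f hf]
  · intro f hf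
    simp
  · intro c a ha f hf
    simp [mul_left_comm _ c, ← Finset.mul_sum, ha f hf]

/-- Let `D ⊆ ℂⁿ × ℂⁿ` be the common zero locus of a set of polynomials in
`(x, v)`, with fibers `ℂ`-linear subspaces. Then the algebraic derived sequence stabilizes:
there is `N` with `D^(N+1) = D^(N)`; moreover every `D^(k)` (in particular the core `D^(N)`)
is an algebraic subset of `ℂⁿ × ℂⁿ` whose fibers are `ℂ`-linear subspaces. -/
theorem algDerivedSeq_stabilizes_and_is_algebraic
    (n : ℕ) (P : Set (MvPolynomial (Fin n ⊕ Fin n) ℂ))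
    (D : Set ((Fin n → ℂ) × (Fin n → ℂ)))
    (hD : D = {xv | ∀ f ∈ P, eval (Sum.elim xv.1 xv.2) f = 0})
    (hlin : ∀ x : Fin n → ℂ, ∃ W : Submodule ℂ (Fin n → ℂ),
      {v | (x, v) ∈ D} = (W : Set (Fin n → ℂ))) :
    (∃ N : ℕ, algDerivedSeq n D (N + 1) = algDerivedSeq n D N) ∧
      ∀ k : ℕ,
        (∃ Q : Set (MvPolynomial (Fin n ⊕ Fin n) ℂ),
          algDerivedSeq n D k = {xv | ∀ f ∈ Q, eval (Sum.elim xv.1 xv.2) f = 0}) ∧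
        (∀ x : Fin n → ℂ, ∃ W : Submodule ℂ (Fin n → ℂ),
          {v | (x, v) ∈ algDerivedSeq n D k} = (W : Set (Fin n → ℂ))) := by
  have hk : ∀ k : ℕ,
      (∃ Q : Set (MvPolynomial (Fin n ⊕ Fin n) ℂ),
        algDerivedSeq n D k = {xv | ∀ f ∈ Q, eval (Sum.elim xv.1 xv.2) f = 0}) ∧
      (∀ x : Fin n → ℂ, ∃ W : Submodule ℂ (Fin n → ℂ),
        {v | (x, v) ∈ algDerivedSeq n D k} = (W : Set (Fin n → ℂ))) := by
    intro k
    induction k with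
    | zero => exact ⟨⟨P, hD⟩, hlin⟩
    | succ k ih =>
      obtain ⟨⟨Q, hQ⟩, hW⟩ := ih
      refine ⟨?_, fun x => ?_⟩
      · obtain ⟨R, hR⟩ := algTangent_eq_zeroLocus n (algSupport n (algDerivedSeq n D k))
        refine ⟨Q ∪ R, ?_⟩
        rw [algDerivedSeq, hR, hQ]
        ext xv
        simp [or_imp, forall_and]
      · obtain ⟨W, hW⟩ := hW x
        obtain ⟨T, hT⟩ :=
          algTangent_fiber_submodule n (algSupport n (algDerivedSeq n D k)) x
        refine ⟨W ⊓ T, ?_⟩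
        rw [Submodule.coe_inf, ← hW, ← hT]
        rfl
  have hanti : Antitone (algDerivedSeq n D) := antitone_nat_of_succ_le fun k => by
    rw [algDerivedSeq]
    exact Set.inter_subset_left
  exact ⟨exists_succ_eq_of_zeroLoci
    (fun xv : (Fin n → ℂ) × (Fin n → ℂ) => Sum.elim xv.1 xv.2) (algDerivedSeq n D) hanti
    fun k => (hk k).1, hk⟩
end

section
/- Let W = {(x,y,z) ∈ ℝ³ : x² − yz² = 0} be the Whitney umbrella. If U is a connected open neighborhood of the origin in ℝ³ and f : U → ℝ is real-analytic on U with f ≡ 0 on W ∩ U, then there exist an open neighborhood V ⊆ U of the origin and a real-analytic function g : V → ℝ such that f(x,y,z) = g(x,y,z)·(x² − yz²) for all (x,y,z) ∈ V. -/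
/-- The Whitney umbrella `W = {(x, y, z) ∈ ℝ³ : x² − yz² = 0}`. -/
def whitneyUmbrella : Set (ℝ × ℝ × ℝ) :=
  {p | p.1 ^ 2 - p.2.1 * p.2.2 ^ 2 = 0}

open Filter Topology

open scoped ENNReal NNReal

section ShiftRealization

variable {V : Type*} [NormedAddCommGroup V] [NormedSpace ℝ V]

/-- Bounded sequences `(qₙ)` of continuous multilinear forms, `qₙ` being `n`-linear. -/
def BoundedForms (V : Type*) [NormedAddCommGroup V] [NormedSpace ℝ V] : Type _ :=
  lp (fun n : ℕ => V [×n]→L[ℝ] ℝ) ∞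

namespace BoundedForms

noncomputable instance : NormedAddCommGroup (BoundedForms V) :=
  inferInstanceAs (NormedAddCommGroup (lp (fun n : ℕ => V [×n]→L[ℝ] ℝ) ∞))

noncomputable instance : NormedSpace ℝ (BoundedForms V) :=
  inferInstanceAs (NormedSpace ℝ (lp (fun n : ℕ => V [×n]→L[ℝ] ℝ) ∞))

instance : CompleteSpace (BoundedForms V) :=
  inferInstanceAs (CompleteSpace (lp (fun n : ℕ => V [×n]→L[ℝ] ℝ) ∞))

/-- The component of degree `n`. -/
noncomputable def coeff (n : ℕ) : BoundedForms V →L[ℝ] V [×n]→L[ℝ] ℝ :=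
  lp.evalCLM ℝ (fun n : ℕ => V [×n]→L[ℝ] ℝ) ∞ n

/-- A sequence of forms with a uniform bound. -/
def ofBound (q : ∀ n : ℕ, V [×n]→L[ℝ] ℝ) (C : ℝ) (hq : ∀ n, ‖q n‖ ≤ C) : BoundedForms V :=
  ⟨q, memℓp_infty ⟨C, by rintro _ ⟨n, rfl⟩; exact hq n⟩⟩

@[simp]
theorem coeff_ofBound (q : ∀ n : ℕ, V [×n]→L[ℝ] ℝ) (C : ℝ) (hq : ∀ n, ‖q n‖ ≤ C) (n : ℕ) :
    coeff n (ofBound q C hq) = q n := rfl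

theorem ext {q r : BoundedForms V} (h : ∀ n, coeff n q = coeff n r) : q = r :=
  lp.ext (funext h)

theorem norm_coeff_le (q : BoundedForms V) (n : ℕ) : ‖coeff n q‖ ≤ ‖q‖ :=
  lp.norm_apply_le_norm (E := fun n : ℕ => V [×n]→L[ℝ] ℝ) ENNReal.top_ne_zero q n

theorem norm_ofBound_le (q : ∀ n : ℕ, V [×n]→L[ℝ] ℝ) (C : ℝ) (hq : ∀ n, ‖q n‖ ≤ C) :
    ‖ofBound q C hq‖ ≤ C :=
  lp.norm_le_of_forall_le (E := fun n : ℕ => V [×n]→L[ℝ] ℝ) ((norm_nonneg _).trans (hq 0)) hq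

end BoundedForms

open BoundedForms

theorem norm_curryLeft_coeff_le (v : V) (q : BoundedForms V) (n : ℕ) :
    ‖(coeff (n + 1) q).curryLeft v‖ ≤ ‖v‖ * ‖q‖ := by
  calc ‖(coeff (n + 1) q).curryLeft v‖ ≤ ‖(coeff (n + 1) q).curryLeft‖ * ‖v‖ :=
        ContinuousLinearMap.le_opNorm _ _
    _ = ‖coeff (n + 1) q‖ * ‖v‖ := by rw [ContinuousMultilinearMap.curryLeft_norm]
    _ ≤ ‖v‖ * ‖q‖ := by
        rw [mul_comm]
        gcongr
        exact norm_coeff_le q (n + 1)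

/-- The shift `(S_v q)ₙ = qₙ₊₁(v, ⋅)`, bilinear in `v` and `q`. -/
noncomputable def formShift (V : Type*) [NormedAddCommGroup V] [NormedSpace ℝ V] :
    V →L[ℝ] BoundedForms V →L[ℝ] BoundedForms V :=
  LinearMap.mkContinuous₂
    (LinearMap.mk₂ ℝ
      (fun v q => ofBound (fun n => (coeff (n + 1) q).curryLeft v) (‖v‖ * ‖q‖)
        (norm_curryLeft_coeff_le v q))
      (fun v w q => BoundedForms.ext fun n => by simp)
      (fun c v q => BoundedForms.ext fun n => by simp)
      (fun v q r => BoundedForms.ext fun n => by ext; simp)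
      (fun c v q => BoundedForms.ext fun n => by ext; simp))
    1
    (fun v q => by
      rw [one_mul]
      exact norm_ofBound_le _ _ (norm_curryLeft_coeff_le v q))

theorem formShift_apply (v : V) (q : BoundedForms V) (n : ℕ) :
    coeff n (formShift V v q) = (coeff (n + 1) q).curryLeft v := rfl

theorem norm_formShift_apply_le (v : V) : ‖formShift V v‖ ≤ ‖v‖ := by
  have h : ‖formShift V‖ ≤ 1 := LinearMap.mkContinuous₂_norm_le _ zero_le_one _
  calc ‖formShift V v‖ ≤ ‖formShift V‖ * ‖v‖ := (formShift V).le_opNorm v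
    _ ≤ 1 * ‖v‖ := by gcongr
    _ = ‖v‖ := one_mul _

/-- Evaluation of the degree zero component. -/
noncomputable def formConst (V : Type*) [NormedAddCommGroup V] [NormedSpace ℝ V] :
    BoundedForms V →L[ℝ] ℝ :=
  (ContinuousMultilinearMap.apply ℝ (fun _ : Fin 0 => V) ℝ 0).comp (coeff 0)

theorem formConst_formShift_pow (v : V) (n : ℕ) (q : BoundedForms V) :
    formConst V ((formShift V v ^ n) q) = coeff n q (fun _ => v) := by
  induction n generalizing q with
  | zero =>
    change coeff 0 q 0 = coeff 0 q fun _ => v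
    congr 1
    exact Subsingleton.elim _ _
  | succ n ih =>
    rw [pow_succ, mul_apply_eq_comp, ih, formShift_apply,
      ContinuousMultilinearMap.curryLeft_apply]
    congr 1
    funext i
    refine Fin.cases rfl (fun _ => rfl) i

/-- An analytic function germ is a matrix coefficient of the resolvent of a linear family of
bounded operators. -/
theorem AnalyticAt.exists_resolvent {f : V → ℝ} (hf : AnalyticAt ℝ f 0) :
    ∃ (L : V →L[ℝ] BoundedForms V →L[ℝ] BoundedForms V) (b : BoundedForms V),
      ∀ᶠ v in 𝓝 0, f v = formConst V (Ring.inverse (1 - L v) b) := by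
  obtain ⟨p, R, hp⟩ := hf
  obtain ⟨r, hr0, hrR⟩ := ENNReal.lt_iff_exists_nnreal_btwn.1 hp.r_pos
  have hr : 0 < (r : ℝ) := by exact_mod_cast hr0
  obtain ⟨C, -, hC⟩ := p.norm_mul_pow_le_of_lt_radius (hrR.trans_le hp.r_le)
  let b : BoundedForms V := ofBound (fun n => (r : ℝ) ^ n • p n) C fun n => by
    simpa [norm_smul, mul_comm] using hC n
  refine ⟨(r : ℝ)⁻¹ • formShift V, b, ?_⟩
  filter_upwards [Metric.ball_mem_nhds (0 : V) hr] with v hv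
  have hv' : ‖v‖ < r := by simpa using hv
  have hL : ‖((r : ℝ)⁻¹ • formShift V) v‖ < 1 := by
    rw [_root_.smul_apply, norm_smul, norm_inv, Real.norm_of_nonneg hr.le,
      inv_mul_lt_iff₀ hr, mul_one]
    exact (norm_formShift_apply_le v).trans_lt hv'
  have hs : HasSum (fun n => (((r : ℝ)⁻¹ • formShift V) v) ^ n)
      (Ring.inverse (1 - ((r : ℝ)⁻¹ • formShift V) v)) := by
    rw [NormedRing.inverse_one_sub _ hL]
    exact (summable_geometric_of_norm_lt_one hL).hasSum
  have h1 := (formConst V).hasSum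
    ((ContinuousLinearMap.apply ℝ (BoundedForms V) b).hasSum hs)
  have h2 : HasSum (fun n => p n fun _ => v) (f v) := by
    have : v ∈ Metric.eball (0 : V) R := by
      rw [Metric.mem_eball, edist_zero_right]
      refine lt_trans ?_ hrR
      rw [← ofReal_norm, ← ENNReal.ofReal_coe_nnreal]
      exact (ENNReal.ofReal_lt_ofReal_iff hr).2 hv'
    simpa using hp.hasSum this
  refine h2.unique (h1.congr_fun fun n => ?_)
  rw [_root_.smul_apply, smul_pow, ContinuousLinearMap.apply_apply, _root_.smul_apply, map_smul,
    formConst_formShift_pow, coeff_ofBound]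
  simp [hr.ne']

end ShiftRealization

section Division

variable {A : Type*} [NormedRing A] [NormedAlgebra ℝ A]

theorem resolvent_eq_quadratic_division {T : A} {x u : ℝ} (hx : IsUnit (1 - x • T))
    (hu : IsUnit (1 - u • T ^ 2)) :
    Ring.inverse (1 - x • T) =
      (x ^ 2 - u) • (Ring.inverse (1 - x • T) * T ^ 2 * Ring.inverse (1 - u • T ^ 2)) +
        (Ring.inverse (1 - u • T ^ 2) + x • (T * Ring.inverse (1 - u • T ^ 2))) := by
  have hP := Ring.inverse_mul_cancel _ hx
  have hQ := Ring.mul_inverse_cancel _ hu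
  set P := Ring.inverse (1 - x • T)
  set Q := Ring.inverse (1 - u • T ^ 2)
  calc P = P * ((1 - u • T ^ 2) * Q) := by rw [hQ, mul_one]
    _ = (x ^ 2 - u) • (P * T ^ 2 * Q) + P * (1 - x • T) * ((1 + x • T) * Q) := by
        simp only [mul_sub, sub_mul, mul_add, add_mul, mul_one, one_mul, smul_mul_assoc,
          mul_smul_comm, smul_smul, sub_smul, pow_two, mul_assoc, smul_sub]
        abel
    _ = _ := by rw [hP]; simp [add_mul]

variable {F : Type*} [NormedAddCommGroup F] [NormedSpace ℝ F]

theorem AnalyticAt.ringInverse [HasSummableGeomSeries A] {f : F → A} {w : F}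
    (hf : AnalyticAt ℝ f w) (h : IsUnit (f w)) :
    AnalyticAt ℝ (fun w => Ring.inverse (f w)) w := by
  obtain ⟨a, ha⟩ := h
  exact AnalyticAt.fun_comp (g := Ring.inverse) (ha ▸ analyticAt_inverse a) hf

theorem Ring.inverse_mul_of_isUnit {R : Type*} [Ring R] {a b : R} (ha : IsUnit a)
    (hb : IsUnit b) : Ring.inverse (a * b) = Ring.inverse b * Ring.inverse a := by
  obtain ⟨a, rfl⟩ := ha
  obtain ⟨b, rfl⟩ := hb
  rw [← Units.val_mul, Ring.inverse_unit, Ring.inverse_unit, Ring.inverse_unit, mul_inv_rev,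
    Units.val_mul]

/-- Weierstrass division of an analytic germ by `x² - u(w)`. -/
theorem AnalyticAt.exists_division_sq_sub {f : ℝ × F → ℝ} (hf : AnalyticAt ℝ f 0) {u : F → ℝ}
    (hu : AnalyticAt ℝ u 0) (hu0 : u 0 = 0) :
    ∃ (g : ℝ × F → ℝ) (a b : F → ℝ), AnalyticAt ℝ g 0 ∧ AnalyticAt ℝ a 0 ∧ AnalyticAt ℝ b 0 ∧
      ∀ᶠ q in 𝓝 (0 : ℝ × F), f q = g q * (q.1 ^ 2 - u q.2) + (a q.2 + q.1 * b q.2) := by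
  obtain ⟨L, c, hL⟩ := hf.exists_resolvent
  let D : F → BoundedForms (ℝ × F) →L[ℝ] BoundedForms (ℝ × F) := fun w => 1 - L (0, w)
  let T : F → BoundedForms (ℝ × F) →L[ℝ] BoundedForms (ℝ × F) :=
    fun w => Ring.inverse (D w) * L (1, 0)
  let h : F → BoundedForms (ℝ × F) := fun w => Ring.inverse (D w) c
  let P : ℝ × F → BoundedForms (ℝ × F) →L[ℝ] BoundedForms (ℝ × F) :=
    fun q => Ring.inverse (1 - q.1 • T q.2)
  let Q : F → BoundedForms (ℝ × F) →L[ℝ] BoundedForms (ℝ × F) :=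
    fun w => Ring.inverse (1 - u w • T w ^ 2)
  have hD : AnalyticAt ℝ D 0 :=
    analyticAt_const.sub ((L.comp (ContinuousLinearMap.inr ℝ ℝ F)).analyticAt 0)
  have hD0 : IsUnit (D 0) := by
    have : L ((0 : ℝ), (0 : F)) = 0 := map_zero L
    simp [D, this]
  have hDi := hD.ringInverse hD0
  have hT : AnalyticAt ℝ T 0 := hDi.mul analyticAt_const
  have hh : AnalyticAt ℝ h 0 :=
    ((ContinuousLinearMap.apply ℝ (BoundedForms (ℝ × F)) c).analyticAt _).fun_comp hDi
  have hP1 : AnalyticAt ℝ (fun q : ℝ × F => 1 - q.1 • T q.2) 0 :=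
    analyticAt_const.sub (analyticAt_fst.smul (hT.fun_comp (g := T) (f := Prod.snd) analyticAt_snd))
  have hP0 : IsUnit ((fun q : ℝ × F => 1 - q.1 • T q.2) 0) := by simp
  have hP : AnalyticAt ℝ P 0 := hP1.ringInverse hP0
  have hQ1 : AnalyticAt ℝ (fun w => 1 - u w • T w ^ 2) 0 :=
    analyticAt_const.sub (hu.smul (hT.pow 2))
  have hQ0 : IsUnit ((fun w => 1 - u w • T w ^ 2) 0) := by simp [hu0]
  have hQ : AnalyticAt ℝ Q 0 := hQ1.ringInverse hQ0
  have ev {G : Type _} [NormedAddCommGroup G] [NormedSpace ℝ G]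
      {M : G → BoundedForms (ℝ × F) →L[ℝ] BoundedForms (ℝ × F)} {k : G → BoundedForms (ℝ × F)}
      (hM : AnalyticAt ℝ M 0) (hk : AnalyticAt ℝ k 0) : AnalyticAt ℝ (fun w => M w (k w)) 0 :=
    AnalyticAt.comp₂ ((ContinuousLinearMap.id ℝ _).analyticAt_bilinear (M 0, k 0)) hM hk
  have hQh : AnalyticAt ℝ (fun w => Q w (h w)) 0 := ev hQ hh
  have snd {G : Type _} [NormedAddCommGroup G] [NormedSpace ℝ G] {k : F → G}
      (hk : AnalyticAt ℝ k 0) : AnalyticAt ℝ (fun q : ℝ × F => k q.2) 0 :=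
    hk.fun_comp (g := k) (f := Prod.snd) analyticAt_snd
  have evUnit {G : Type _} [NormedAddCommGroup G] [NormedSpace ℝ G]
      {k : G → BoundedForms (ℝ × F) →L[ℝ] BoundedForms (ℝ × F)}
      (hk : AnalyticAt ℝ k 0) (hk0 : IsUnit (k 0)) : ∀ᶠ w in 𝓝 0, IsUnit (k w) :=
    hk.continuousAt (Units.isOpen.mem_nhds hk0)
  have tsnd : Tendsto (Prod.snd : ℝ × F → F) (𝓝 0) (𝓝 0) := continuous_snd.tendsto 0
  refine ⟨fun q => formConst _ ((P q * T q.2 ^ 2) (Q q.2 (h q.2))),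
    fun w => formConst _ (Q w (h w)), fun w => formConst _ (T w (Q w (h w))),
    ((formConst _).analyticAt _).fun_comp (ev (hP.mul ((snd hT).pow 2)) (snd hQh)),
    ((formConst _).analyticAt _).fun_comp hQh,
    ((formConst _).analyticAt _).fun_comp (ev hT hQh), ?_⟩
  filter_upwards [hL, tsnd.eventually (evUnit hD hD0), evUnit hP1 hP0,
    tsnd.eventually (evUnit hQ1 hQ0)] with q hq hDq hPq hQq
  have hfac : 1 - L q = D q.2 * (1 - q.1 • T q.2) := by
    have h1 : L q = q.1 • L (1, 0) + L (0, q.2) := by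
      rw [← map_smul, ← map_add]; simp
    have h2 : D q.2 * T q.2 = L (1, 0) := by
      rw [← mul_assoc, Ring.mul_inverse_cancel _ hDq, one_mul]
    rw [mul_sub, mul_one, mul_smul_comm, h2, h1]
    simp only [D]
    abel
  have key := congrArg (fun M : BoundedForms (ℝ × F) →L[ℝ] BoundedForms (ℝ × F) =>
    formConst _ (M (h q.2))) (resolvent_eq_quadratic_division hPq hQq)
  rw [hq, hfac, Ring.inverse_mul_of_isUnit hDq hPq]
  refine key.trans ?_
  simp only [_root_.add_apply, _root_.smul_apply, map_add, map_smul,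
    mul_apply_eq_comp, smul_eq_mul, P, Q]
  ring

end Division

/-- An analytic germ on `ℝ²` that vanishes on the open first quadrant near `0` is zero. -/
theorem AnalyticAt.eventually_eq_zero_of_quadrant {a : ℝ × ℝ → ℝ} (ha : AnalyticAt ℝ a 0)
    (h : ∀ᶠ w in 𝓝 (0 : ℝ × ℝ), 0 < w.1 → 0 < w.2 → a w = 0) : ∀ᶠ w in 𝓝 0, a w = 0 := by
  obtain ⟨ε, hε, hball⟩ := Metric.eventually_nhds_iff_ball.1 (ha.eventually_analyticAt.and h)
  have hmem : ((ε / 2, ε / 2) : ℝ × ℝ) ∈ Metric.ball (0 : ℝ × ℝ) ε := by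
    simp [Prod.norm_def, abs_of_pos hε, hε]
  have hzero : a =ᶠ[𝓝 (ε / 2, ε / 2)] 0 := by
    filter_upwards [Metric.isOpen_ball.mem_nhds hmem,
      (isOpen_Ioi.prod isOpen_Ioi).mem_nhds
        (show ((ε / 2, ε / 2) : ℝ × ℝ) ∈ Set.Ioi 0 ×ˢ Set.Ioi 0 from
          ⟨half_pos hε, half_pos hε⟩)] with w hw hpos
    exact (hball w hw).2 hpos.1 hpos.2
  have han : AnalyticOnNhd ℝ a (Metric.ball 0 ε) := fun w hw => (hball w hw).1
  have := han.eqOn_zero_of_preconnected_of_eventuallyEq_zero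
    (convex_ball (0 : ℝ × ℝ) ε).isPreconnected hmem hzero
  filter_upwards [Metric.ball_mem_nhds (0 : ℝ × ℝ) hε] with w hw using this hw

/-- If `U` is a connected open neighborhood of the origin in `ℝ³` and
`f : U → ℝ` is real-analytic with `f ≡ 0` on `W ∩ U` (where `W` is the Whitney umbrella),
then on some open neighborhood `V ⊆ U` of the origin one can write
`f(x,y,z) = g(x,y,z)·(x² − yz²)` with `g` real-analytic on `V`. -/
theorem whitney_umbrella_division
    (U : Set (ℝ × ℝ × ℝ)) (hUopen : IsOpen U) (hU0 : (0 : ℝ × ℝ × ℝ) ∈ U)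
    (hUconn : IsConnected U)
    (f : ℝ × ℝ × ℝ → ℝ) (hf : AnalyticOnNhd ℝ f U)
    (hfW : ∀ q ∈ whitneyUmbrella ∩ U, f q = 0) :
    ∃ V : Set (ℝ × ℝ × ℝ), IsOpen V ∧ (0 : ℝ × ℝ × ℝ) ∈ V ∧ V ⊆ U ∧
      ∃ g : ℝ × ℝ × ℝ → ℝ, AnalyticOnNhd ℝ g V ∧
        ∀ q ∈ V, f q = g q * (q.1 ^ 2 - q.2.1 * q.2.2 ^ 2) := by
  have hu : AnalyticAt ℝ (fun w : ℝ × ℝ => w.1 * w.2 ^ 2) 0 :=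
    analyticAt_fst.mul (analyticAt_snd.pow 2)
  obtain ⟨g, a, b, hg, ha, hb, hdiv⟩ := (hf 0 hU0).exists_division_sq_sub hu (by simp)
  have hrem : ∀ᶠ q in 𝓝 (0 : ℝ × ℝ × ℝ), q.1 ^ 2 = q.2.1 * q.2.2 ^ 2 →
      a q.2 + q.1 * b q.2 = 0 := by
    filter_upwards [hdiv, hUopen.mem_nhds hU0] with q hq hqU hqW
    have h0 : q.1 ^ 2 - q.2.1 * q.2.2 ^ 2 = 0 := sub_eq_zero.2 hqW
    rw [hfW q ⟨h0, hqU⟩, h0] at hq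
    linarith
  have lift (s : ℝ) : Tendsto (fun w : ℝ × ℝ => (s * (√w.1 * w.2), w)) (𝓝 0)
      (𝓝 (0 : ℝ × ℝ × ℝ)) := by
    have : Continuous fun w : ℝ × ℝ => (s * (√w.1 * w.2), w) := by fun_prop
    simpa [Prod.zero_eq_mk] using this.tendsto 0
  have hab : ∀ᶠ w in 𝓝 (0 : ℝ × ℝ), 0 < w.1 → 0 < w.2 → a w = 0 ∧ b w = 0 := by
    filter_upwards [(lift 1).eventually hrem, (lift (-1)).eventually hrem] with w h1 h2 hy hz
    have hsq : √w.1 ^ 2 = w.1 := Real.sq_sqrt hy.le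
    have e1 := h1 (by simp [mul_pow, hsq])
    have e2 := h2 (by simp [mul_pow, hsq])
    have ha0 : a w = 0 := by linarith
    have hpos : 0 < √w.1 * w.2 := mul_pos (Real.sqrt_pos.2 hy) hz
    refine ⟨ha0, ?_⟩
    rw [ha0, zero_add, one_mul] at e1
    exact (mul_eq_zero.1 e1).resolve_left hpos.ne'
  have ha0 := ha.eventually_eq_zero_of_quadrant (hab.mono fun w h h1 h2 => (h h1 h2).1)
  have hb0 := hb.eventually_eq_zero_of_quadrant (hab.mono fun w h h1 h2 => (h h1 h2).2)
  have tsnd : Tendsto (Prod.snd : ℝ × ℝ × ℝ → ℝ × ℝ) (𝓝 0) (𝓝 0) := continuous_snd.tendsto 0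
  have hV : ∀ᶠ q in 𝓝 (0 : ℝ × ℝ × ℝ), q ∈ U ∧ AnalyticAt ℝ g q ∧
      f q = g q * (q.1 ^ 2 - q.2.1 * q.2.2 ^ 2) := by
    filter_upwards [hUopen.mem_nhds hU0, hg.eventually_analyticAt, hdiv, tsnd.eventually ha0,
      tsnd.eventually hb0] with q hqU hqg hq hqa hqb
    refine ⟨hqU, hqg, ?_⟩
    rw [hq, hqa, hqb]
    ring
  obtain ⟨V, hVsub, hVopen, hV0⟩ := eventually_nhds_iff.1 hV
  exact ⟨V, hVopen, hV0, fun q hq => (hVsub q hq).1, g, fun q hq => (hVsub q hq).2.1,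
    fun q hq => (hVsub q hq).2.2⟩
end

section
/- Let W = {(x,y,z) ∈ ℝ³ : x² − yz² = 0} be the Whitney umbrella. For every r > 0, the set W ∩ {y ≥ 0} ∩ B is not the common zero set in B of any family of real-analytic functions on B, where B is the open ball of radius r centered at the origin in ℝ³. That is, there is no set F of functions, each real-analytic on B, with {q ∈ B : f(q) = 0 for all f ∈ F} = W ∩ {(x,y,z) : y ≥ 0} ∩ B. -/
/-- The Whitney umbrella in `ℝ³` (with the Euclidean metric),
`W = {q : (q 0)² − (q 1)(q 2)² = 0}`. -/
def whitneyUmbrellaE : Set (EuclideanSpace ℝ (Fin 3)) :=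
  {q | (q 0) ^ 2 - q 1 * (q 2) ^ 2 = 0}

/-- Let `W` be the Whitney umbrella and let `B` be the open Euclidean ball
of radius `r > 0` centered at the origin of `ℝ³`. Then `W ∩ {y ≥ 0} ∩ B` is not the common
zero set in `B` of any family of real-analytic functions on `B`. -/
theorem whitney_half_not_analytic_subset
    (r : ℝ) (hr : 0 < r) :
    ¬ ∃ F : Set (EuclideanSpace ℝ (Fin 3) → ℝ),
        (∀ f ∈ F, AnalyticOnNhd ℝ f (Metric.ball (0 : EuclideanSpace ℝ (Fin 3)) r)) ∧
        {q ∈ Metric.ball (0 : EuclideanSpace ℝ (Fin 3)) r | ∀ f ∈ F, f q = 0} =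
          whitneyUmbrellaE ∩ {q : EuclideanSpace ℝ (Fin 3) | 0 ≤ q 1} ∩
            Metric.ball (0 : EuclideanSpace ℝ (Fin 3)) r := by
  rintro ⟨F, hF, hzero⟩
  set e : EuclideanSpace ℝ (Fin 3) := EuclideanSpace.single 1 1 with he
  have mem_ball : ∀ t : ℝ, t • e ∈ Metric.ball (0 : EuclideanSpace ℝ (Fin 3)) r ↔ |t| < r := by
    intro t
    simp [he, norm_smul]
  have vanish : ∀ f ∈ F, ∀ t ∈ Set.Ioo (-r) r, f (t • e) = 0 := by
    intro f hf
    have hg : AnalyticOnNhd ℝ (fun t : ℝ => f (t • e)) (Set.Ioo (-r) r) := by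
      intro t ht
      have hline : AnalyticAt ℝ (fun s : ℝ => s • e) t := by fun_prop
      exact (hF f hf (t • e) ((mem_ball t).2 (abs_lt.2 ht))).comp_of_eq hline rfl
    refine hg.eqOn_zero_of_preconnected_of_eventuallyEq_zero isPreconnected_Ioo
      (z₀ := r / 2) ⟨by linarith, by linarith⟩ ?_
    filter_upwards [Ioo_mem_nhds (half_pos hr) (half_lt_self hr)] with t ht
    have hball := (mem_ball t).2 (abs_lt.2 ⟨by linarith [ht.1], ht.2⟩)
    have hmem : t • e ∈ whitneyUmbrellaE ∩ {q : EuclideanSpace ℝ (Fin 3) | 0 ≤ q 1} ∩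
        Metric.ball (0 : EuclideanSpace ℝ (Fin 3)) r :=
      ⟨⟨by simp [whitneyUmbrellaE, he], by simpa [he] using ht.1.le⟩, hball⟩
    rw [← hzero] at hmem
    exact hmem.2 f hf
  have hneg : -(r / 2) ∈ Set.Ioo (-r) r := ⟨by linarith, by linarith⟩
  have hmem : (-(r / 2)) • e ∈ {q ∈ Metric.ball (0 : EuclideanSpace ℝ (Fin 3)) r |
      ∀ f ∈ F, f q = 0} :=
    ⟨(mem_ball _).2 (abs_lt.2 hneg), fun f hf => vanish f hf _ hneg⟩
  rw [hzero] at hmem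
  have hnonneg : 0 ≤ ((-(r / 2)) • e) 1 := hmem.1.2
  simp [he] at hnonneg
  linarith
end

section
/- Let C ⊆ [0,1] be a nonempty compact set satisfying the self-similarity relation C = (1/5)·C ∪ ((1/5)·C + 4/5). Then the Hausdorff dimension of C equals log 2 / log 5; in particular dim_H C < 1/2. -/
open Set Filter Topology MeasureTheory
open scoped NNReal ENNReal

/-- The Hausdorff dimension `log 2 / log 5` of the Cantor set with contraction ratio `1/5` solves
`5 ^ s = 2`. -/
theorem five_rpow_log_two_div_log_five : (5 : ℝ) ^ (Real.log 2 / Real.log 5) = 2 := by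
  rw [Real.rpow_def_of_pos (by norm_num), mul_div_cancel₀ _ (Real.log_pos (by norm_num)).ne',
    Real.exp_log (by norm_num)]

/-- A Cantor-type function: bounded by `0` and `1`, and semiconjugating the inverse branches
`5 x` and `5 x - 4` to the inverse branches of the binary expansion. -/
theorem exists_cantor_function : ∃ f : ℝ → ℝ, (∀ x, f x ∈ Icc (0 : ℝ) 1) ∧
    (∀ x, f (5 * x) = 2 * f x ∨ 1 / 2 < x) ∧ (∀ x, f (5 * x - 4) = 2 * f x - 1 ∨ x ≤ 1 / 2) := by
  let b : ℝ → ℝ := fun x => if x ≤ 1 / 2 then 0 else 1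
  let T : ℝ → ℝ := fun x => if x ≤ 1 / 2 then 5 * x else 5 * x - 4
  have hb0 : ∀ x, 0 ≤ b x := fun x => by simp only [b]; split_ifs <;> norm_num
  have hb1 : ∀ x, b x ≤ 1 := fun x => by simp only [b]; split_ifs <;> norm_num
  let u : ℝ → ℕ → ℝ := fun x n => b (T^[n] x) * (1 / 2 / 2 ^ n)
  have hu0 : ∀ x n, 0 ≤ u x n := fun x n => mul_nonneg (hb0 _) (by positivity)
  have hu1 : ∀ x n, u x n ≤ 1 / 2 / 2 ^ n := fun x n =>
    mul_le_of_le_one_left (by positivity) (hb1 _)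
  have hu : ∀ x, Summable (u x) := fun x =>
    Summable.of_nonneg_of_le (hu0 x) (hu1 x) (summable_geometric_two' 1)
  have hstep : ∀ x, ∑' n, u x n = b x / 2 + (∑' n, u (T x) n) / 2 := by
    intro x
    rw [(hu x).tsum_eq_zero_add, ← tsum_div_const]
    congr 1
    · simp only [u, Function.iterate_zero, id, pow_zero]; ring
    · refine tsum_congr fun n => ?_
      simp only [u, Function.iterate_succ_apply, pow_succ]
      field_simp
  refine ⟨fun x => ∑' n, u x n, fun x => ⟨tsum_nonneg (hu0 x), ?_⟩, fun x => ?_, fun x => ?_⟩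
  · exact ((hu x).tsum_le_tsum (hu1 x) (summable_geometric_two' 1)).trans_eq
      (tsum_geometric_two' 1)
  · rcases le_or_gt x (1 / 2) with h | h
    · left
      have := hstep x
      simp only [b, T, if_pos h] at this ⊢
      linarith
    · exact Or.inr h
  · rcases le_or_gt x (1 / 2) with h | h
    · exact Or.inr h
    · left
      have := hstep x
      simp only [b, T, if_neg h.not_ge] at this ⊢
      linarith

theorem cantor_function_div_five {C : Set ℝ} {f : ℝ → ℝ} (hC : C ⊆ Icc 0 1)
    (hf0 : ∀ x, f (5 * x) = 2 * f x ∨ 1 / 2 < x)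
    {x : ℝ} (hx : x ∈ C) : f (x / 5) = f x / 2 := by
  rcases hf0 (x / 5) with h | h
  · rw [mul_div_cancel₀ _ (by norm_num)] at h; linarith
  · linarith [(hC hx).2]

theorem cantor_function_div_five_add {C : Set ℝ} {f : ℝ → ℝ} (hC : C ⊆ Icc 0 1)
    (hf1 : ∀ x, f (5 * x - 4) = 2 * f x - 1 ∨ x ≤ 1 / 2)
    {x : ℝ} (hx : x ∈ C) :
    f (x / 5 + 4 / 5) = f x / 2 + 1 / 2 := by
  rcases hf1 (x / 5 + 4 / 5) with h | h
  · rw [show 5 * (x / 5 + 4 / 5) - 4 = x by ring] at h; linarith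
  · linarith [(hC hx).1]

/-- The Cantor function is Hölder continuous on `C` at every positive scale. -/
theorem cantor_function_abs_sub_le {C : Set ℝ} {f : ℝ → ℝ} (hC : C ⊆ Icc 0 1)
    (hself : C = (fun t : ℝ => t / 5) '' C ∪ (fun t : ℝ => t / 5 + 4 / 5) '' C)
    (hf : ∀ x, f x ∈ Icc (0 : ℝ) 1)
    (hf0 : ∀ x, f (5 * x) = 2 * f x ∨ 1 / 2 < x)
    (hf1 : ∀ x, f (5 * x - 4) = 2 * f x - 1 ∨ x ≤ 1 / 2)
    {s : ℝ} (hs : 0 < s) (h5 : (5 : ℝ) ^ s = 2) (n : ℕ) :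
    ∀ x ∈ C, ∀ y ∈ C, (1 / 5 : ℝ) ^ n ≤ |x - y| → |f x - f y| ≤ 2 * |x - y| ^ s := by
  have hscale : ∀ r : ℝ, 0 ≤ r → (r / 5) ^ s = r ^ s / 2 := fun r hr => by
    rw [Real.div_rpow hr (by norm_num), h5]
  have hfar : ∀ x y : ℝ, 1 / 5 ≤ |x - y| → |f x - f y| ≤ 2 * |x - y| ^ s := by
    intro x y h
    have h1 : |f x - f y| ≤ 1 :=
      abs_le.2 ⟨by linarith [(hf x).1, (hf y).2], by linarith [(hf x).2, (hf y).1]⟩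
    have h2 : (1 / 5 : ℝ) ^ s ≤ |x - y| ^ s := Real.rpow_le_rpow (by norm_num) h hs.le
    rw [hscale 1 zero_le_one, Real.one_rpow] at h2
    linarith
  induction n with
  | zero =>
    intro x _ y _ h
    exact hfar x y (by rw [pow_zero] at h; linarith)
  | succ n ih =>
    intro x hx y hy h
    rw [hself] at hx hy
    rcases hx with ⟨x, hx, rfl⟩ | ⟨x, hx, rfl⟩ <;> rcases hy with ⟨y, hy, rfl⟩ | ⟨y, hy, rfl⟩ <;>
      dsimp only at h ⊢
    · have e : |x / 5 - y / 5| = |x - y| / 5 := by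
        rw [← sub_div, abs_div, abs_of_pos (by norm_num : (0 : ℝ) < 5)]
      rw [e, pow_succ] at h
      rw [e, hscale _ (abs_nonneg _), cantor_function_div_five hC hf0 hx,
        cantor_function_div_five hC hf0 hy, ← sub_div, abs_div, abs_two]
      linarith [ih x hx y hy (by linarith)]
    · refine hfar _ _ ?_
      rw [abs_sub_comm]
      refine le_trans ?_ (le_abs_self _)
      linarith [(hC hx).2, (hC hy).1]
    · refine hfar _ _ (le_trans ?_ (le_abs_self _))
      linarith [(hC hx).1, (hC hy).2]
    · have e : |x / 5 + 4 / 5 - (y / 5 + 4 / 5)| = |x - y| / 5 := by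
        rw [add_sub_add_right_eq_sub, ← sub_div, abs_div, abs_of_pos (by norm_num : (0 : ℝ) < 5)]
      rw [e, pow_succ] at h
      rw [e, hscale _ (abs_nonneg _), cantor_function_div_five_add hC hf1 hx,
        cantor_function_div_five_add hC hf1 hy, add_sub_add_right_eq_sub, ← sub_div, abs_div,
        abs_two]
      linarith [ih x hx y hy (by linarith)]

theorem cantor_function_holderOnWith {C : Set ℝ} {f : ℝ → ℝ} (hC : C ⊆ Icc 0 1)
    (hself : C = (fun t : ℝ => t / 5) '' C ∪ (fun t : ℝ => t / 5 + 4 / 5) '' C)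
    (hf : ∀ x, f x ∈ Icc (0 : ℝ) 1)
    (hf0 : ∀ x, f (5 * x) = 2 * f x ∨ 1 / 2 < x)
    (hf1 : ∀ x, f (5 * x - 4) = 2 * f x - 1 ∨ x ≤ 1 / 2)
    {s : ℝ≥0} (hs : 0 < s) (h5 : (5 : ℝ) ^ (s : ℝ) = 2) :
    HolderOnWith 2 s f C := by
  intro x hx y hy
  rcases eq_or_ne x y with rfl | hxy
  · simp
  obtain ⟨n, hn⟩ := exists_pow_lt_of_lt_one (abs_pos.2 (sub_ne_zero.2 hxy))
    (by norm_num : (1 / 5 : ℝ) < 1)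
  have h := cantor_function_abs_sub_le hC hself hf hf0 hf1 (NNReal.coe_pos.2 hs) h5 n
    x hx y hy hn.le
  rw [edist_dist, edist_dist, Real.dist_eq, Real.dist_eq,
    ENNReal.ofReal_rpow_of_nonneg (abs_nonneg _) s.coe_nonneg]
  refine (ENNReal.ofReal_le_ofReal h).trans_eq ?_
  rw [ENNReal.ofReal_mul zero_le_two]
  norm_num

/-- The image of `C` under the Cantor function is dense in `[0,1]`. -/
theorem exists_cantor_function_near {C : Set ℝ} {f : ℝ → ℝ} (hC : C ⊆ Icc 0 1)
    (hself : C = (fun t : ℝ => t / 5) '' C ∪ (fun t : ℝ => t / 5 + 4 / 5) '' C)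
    (hf0 : ∀ x, f (5 * x) = 2 * f x ∨ 1 / 2 < x)
    (hf1 : ∀ x, f (5 * x - 4) = 2 * f x - 1 ∨ x ≤ 1 / 2)
    (hf : ∀ x, f x ∈ Icc (0 : ℝ) 1) (hne : C.Nonempty) (n : ℕ) :
    ∀ t ∈ Icc (0 : ℝ) 1, ∃ x ∈ C, |t - f x| ≤ (1 / 2) ^ n := by
  induction n with
  | zero =>
    intro t ht
    obtain ⟨x, hx⟩ := hne
    exact ⟨x, hx, abs_le.2 ⟨by linarith [ht.1, (hf x).2], by linarith [ht.2, (hf x).1]⟩⟩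
  | succ n ih =>
    intro t ht
    rcases le_total t (1 / 2) with h | h
    · obtain ⟨x, hx, hxt⟩ := ih (2 * t) ⟨by linarith [ht.1], by linarith⟩
      refine ⟨x / 5, hself ▸ Or.inl ⟨x, hx, rfl⟩, ?_⟩
      rw [cantor_function_div_five hC hf0 hx, pow_succ]
      rw [abs_le] at hxt ⊢
      constructor <;> linarith
    · obtain ⟨x, hx, hxt⟩ := ih (2 * t - 1) ⟨by linarith, by linarith [ht.2]⟩
      refine ⟨x / 5 + 4 / 5, hself ▸ Or.inr ⟨x, hx, rfl⟩, ?_⟩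
      rw [cantor_function_div_five_add hC hf1 hx, pow_succ]
      rw [abs_le] at hxt ⊢
      constructor <;> linarith

theorem le_dimH_cantor {C : Set ℝ} (hC : C ⊆ Icc 0 1)
    (hself : C = (fun t : ℝ => t / 5) '' C ∪ (fun t : ℝ => t / 5 + 4 / 5) '' C)
    (hne : C.Nonempty) (hcomp : IsCompact C) {s : ℝ≥0} (hs : 0 < s)
    (h5 : (5 : ℝ) ^ (s : ℝ) = 2) : (s : ℝ≥0∞) ≤ dimH C := by
  obtain ⟨f, hf, hf0, hf1⟩ := exists_cantor_function
  have hH := cantor_function_holderOnWith hC hself hf hf0 hf1 hs h5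
  have hsurj : Icc (0 : ℝ) 1 ⊆ f '' C := by
    intro t ht
    rw [← (hcomp.image_of_continuousOn (hH.continuousOn hs)).isClosed.closure_eq,
      Metric.mem_closure_iff]
    intro ε hε
    obtain ⟨n, hn⟩ := exists_pow_lt_of_lt_one hε (by norm_num : (1 / 2 : ℝ) < 1)
    obtain ⟨x, hx, hxt⟩ := exists_cantor_function_near hC hself hf0 hf1 hf hne n t ht
    exact ⟨f x, mem_image_of_mem f hx, hxt.trans_lt hn⟩
  have h1 : dimH (Icc (0 : ℝ) 1) = 1 := by
    rw [Real.dimH_of_nonempty_interior (by rw [interior_Icc]; exact nonempty_Ioo.2 zero_lt_one)]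
    simp
  have h : 1 ≤ dimH C / s := h1 ▸ (dimH_mono hsurj).trans (hH.dimH_image_le hs)
  rwa [ENNReal.le_div_iff_mul_le (Or.inl (by exact_mod_cast hs.ne')) (Or.inl ENNReal.coe_ne_top),
    one_mul] at h

/-- `C` is covered by `2 ^ n` intervals of length `5⁻ⁿ`. -/
theorem exists_cantor_cover {C : Set ℝ} (hC : C ⊆ Icc 0 1)
    (hself : C = (fun t : ℝ => t / 5) '' C ∪ (fun t : ℝ => t / 5 + 4 / 5) '' C)
    (n : ℕ) :
    ∃ E : Finset ℝ, E.card ≤ 2 ^ n ∧ C ⊆ ⋃ a : E, Icc (a : ℝ) (a + (1 / 5) ^ n) := by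
  classical
  induction n with
  | zero => exact ⟨{0}, by simp, fun x hx => by simpa using hC hx⟩
  | succ n ih =>
    obtain ⟨E, hE, hCE⟩ := ih
    refine ⟨E.image (fun t => t / 5) ∪ E.image (fun t => t / 5 + 4 / 5), ?_, ?_⟩
    · refine (Finset.card_union_le _ _).trans ?_
      have h0 := Finset.card_image_le (s := E) (f := fun t : ℝ => t / 5)
      have h1 := Finset.card_image_le (s := E) (f := fun t : ℝ => t / 5 + 4 / 5)
      rw [pow_succ]
      omega
    · intro x hx
      rw [hself] at hx
      rcases hx with ⟨x, hx, rfl⟩ | ⟨x, hx, rfl⟩ <;>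
        obtain ⟨⟨a, ha⟩, hxa⟩ := mem_iUnion.1 (hCE hx) <;> rw [mem_iUnion]
      · refine ⟨⟨a / 5, Finset.mem_union_left _ (Finset.mem_image_of_mem _ ha)⟩, ?_⟩
        simp only [mem_Icc, pow_succ] at hxa ⊢
        constructor <;> linarith
      · refine ⟨⟨a / 5 + 4 / 5, Finset.mem_union_right _
          (Finset.mem_image_of_mem (fun t : ℝ => t / 5 + 4 / 5) ha)⟩, ?_⟩
        simp only [mem_Icc, pow_succ] at hxa ⊢
        constructor <;> linarith

theorem dimH_cantor_le {C : Set ℝ} (hC : C ⊆ Icc 0 1)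
    (hself : C = (fun t : ℝ => t / 5) '' C ∪ (fun t : ℝ => t / 5 + 4 / 5) '' C)
    {s : ℝ≥0} (h5 : (5 : ℝ) ^ (s : ℝ) = 2) : dimH C ≤ s := by
  choose E hE hCE using exists_cantor_cover hC hself
  have hdiam : ∀ n (a : E n),
      Metric.ediam (Icc (a : ℝ) (a + (1 / 5) ^ n)) = ENNReal.ofReal ((1 / 5) ^ n) := fun n a => by
    rw [Real.ediam_Icc, add_sub_cancel_left]
  have hlim : Tendsto (fun n : ℕ => ENNReal.ofReal ((1 / 5 : ℝ) ^ n)) atTop (𝓝 0) := by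
    rw [← ENNReal.ofReal_zero]
    exact ENNReal.tendsto_ofReal
      (tendsto_pow_atTop_nhds_zero_of_lt_one (by norm_num) (by norm_num))
  have hpow : ∀ n : ℕ, ((1 / 5 : ℝ) ^ n) ^ (s : ℝ) = (1 / 2) ^ n := fun n => by
    rw [← Real.rpow_natCast_mul (by norm_num), mul_comm, Real.rpow_mul_natCast (by norm_num),
      Real.div_rpow (by norm_num) (by norm_num), h5, Real.one_rpow]
  have hsum : ∀ n, ∑ a : E n, Metric.ediam (Icc (a : ℝ) (a + (1 / 5) ^ n)) ^ (s : ℝ) ≤ 1 := by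
    intro n
    simp only [hdiam]
    rw [Finset.sum_const, Finset.card_univ, Fintype.card_coe,
      ENNReal.ofReal_rpow_of_nonneg (by positivity) s.coe_nonneg, hpow, nsmul_eq_mul,
      ← ENNReal.ofReal_natCast, ← ENNReal.ofReal_mul (Nat.cast_nonneg _), ENNReal.ofReal_le_one]
    calc ((E n).card : ℝ) * (1 / 2) ^ n ≤ 2 ^ n * (1 / 2) ^ n := by
          gcongr; exact_mod_cast hE n
      _ = 1 := by rw [← mul_pow]; norm_num
  have hμ : μH[(s : ℝ)] C ≤ 1 :=
    (Measure.hausdorffMeasure_le_liminf_sum (s : ℝ) C _ hlim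
      (fun n (a : E n) => Icc (a : ℝ) (a + (1 / 5) ^ n))
      (Eventually.of_forall fun n a => (hdiam n a).le) (Eventually.of_forall hCE)).trans
    ((liminf_le_liminf (Eventually.of_forall hsum)).trans_eq (liminf_const _))
  exact dimH_le_of_hausdorffMeasure_ne_top (ne_top_of_le_ne_top ENNReal.one_ne_top hμ)

/-- Let `C ⊆ [0,1]` be a nonempty compact set with
`C = (1/5)·C ∪ ((1/5)·C + 4/5)`. Then `dim_H C = log 2 / log 5 < 1/2`. -/
theorem hausdorff_dimension_cantor_fifth
    (C : Set ℝ) (hC : C ⊆ Set.Icc 0 1) (hne : C.Nonempty) (hcomp : IsCompact C)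
    (hself : C = (fun t : ℝ => t / 5) '' C ∪ (fun t : ℝ => t / 5 + 4 / 5) '' C) :
    dimH C = ENNReal.ofReal (Real.log 2 / Real.log 5) ∧ dimH C < 1 / 2 := by
  have hlog2 : 0 < Real.log 2 := Real.log_pos (by norm_num)
  have hlog5 : 0 < Real.log 5 := Real.log_pos (by norm_num)
  have hs : 0 < Real.log 2 / Real.log 5 := div_pos hlog2 hlog5
  have h5 : (5 : ℝ) ^ ((Real.log 2 / Real.log 5).toNNReal : ℝ) = 2 := by
    rw [Real.coe_toNNReal _ hs.le, five_rpow_log_two_div_log_five]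
  have hdim : dimH C = ENNReal.ofReal (Real.log 2 / Real.log 5) :=
    le_antisymm (dimH_cantor_le hC hself h5)
      (le_dimH_cantor hC hself hne hcomp (Real.toNNReal_pos.2 hs) h5)
  refine ⟨hdim, ?_⟩
  have hhalf : Real.log 2 / Real.log 5 < 1 / 2 := by
    rw [div_lt_iff₀ hlog5]
    have h4 : Real.log (2 ^ 2) < Real.log 5 := Real.log_lt_log (by norm_num) (by norm_num)
    rw [Real.log_pow] at h4
    push_cast at h4
    linarith
  rw [hdim, show (1 / 2 : ℝ≥0∞) = ENNReal.ofReal (1 / 2) by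
    rw [ENNReal.ofReal_div_of_pos two_pos]; simp]
  exact (ENNReal.ofReal_lt_ofReal_iff (by norm_num)).2 hhalf
end

section
/- There exists a nonempty compact set C ⊆ [0,1] such that the set K = C × C ⊆ ℝ² has Hausdorff dimension equal to 1 but vanishing 1-dimensional Hausdorff measure: dim_H K = 1 and H¹(K) = 0. -/
open MeasureTheory

open Filter Topology Real
open scoped NNReal ENNReal

section Coding

variable {X : Type*} [MetricSpace X] {b : ℕ} {g : (ℕ → Fin b) → X}

/-- If sequences of digits that agree below `n` are coded by points at distance at most `r n`,
and `b ^ n * r n` tends to zero, then the set of all coded points has zero length. -/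
theorem hausdorffMeasure_one_range_eq_zero [MeasurableSpace X] [BorelSpace X] (hb : 1 < b)
    {r : ℕ → ℝ} (hg : ∀ n ω ω', (∀ i < n, ω i = ω' i) → dist (g ω) (g ω') ≤ r n)
    (hr : Tendsto (fun n => (b : ℝ) ^ n * r n) atTop (𝓝 0)) :
    μH[1] (Set.range g) = 0 := by
  have h0 : 0 < b := by omega
  have hr0 : ∀ n, 0 ≤ r n := fun n =>
    dist_nonneg.trans (hg n (fun _ => ⟨0, h0⟩) (fun _ => ⟨0, h0⟩) fun _ _ => rfl)
  have hr' : Tendsto r atTop (𝓝 0) := by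
    refine squeeze_zero hr0 (fun n => ?_) hr
    exact le_mul_of_one_le_left (hr0 n) (one_le_pow₀ (by exact_mod_cast hb.le))
  let t : ∀ n : ℕ, (Fin n → Fin b) → Set X := fun n w => g '' {ω | ∀ i : Fin n, ω i = w i}
  have hdiam : ∀ n w, Metric.ediam (t n w) ≤ ENNReal.ofReal (r n) := by
    intro n w
    refine Metric.ediam_le ?_
    rintro _ ⟨ω, hω, rfl⟩ _ ⟨ω', hω', rfl⟩
    rw [edist_dist]
    refine ENNReal.ofReal_le_ofReal (hg n ω ω' fun i hi => ?_)
    exact (hω ⟨i, hi⟩).trans (hω' ⟨i, hi⟩).symm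
  have hcover : ∀ n, Set.range g ⊆ ⋃ w, t n w := by
    rintro n _ ⟨ω, rfl⟩
    exact Set.mem_iUnion.2 ⟨fun i => ω i, ω, fun _ => rfl, rfl⟩
  have hsum : ∀ n, ∑ w, Metric.ediam (t n w) ^ (1 : ℝ) ≤
      ENNReal.ofReal ((b : ℝ) ^ n * r n) := by
    intro n
    calc ∑ w, Metric.ediam (t n w) ^ (1 : ℝ)
        ≤ ∑ _w : Fin n → Fin b, ENNReal.ofReal (r n) := by
          refine Finset.sum_le_sum fun w _ => ?_
          rw [ENNReal.rpow_one]
          exact hdiam n w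
      _ = ENNReal.ofReal ((b : ℝ) ^ n * r n) := by
          rw [ENNReal.ofReal_mul (by positivity), ENNReal.ofReal_pow (by positivity)]
          simp
  have hlim : Tendsto (fun n => ∑ w, Metric.ediam (t n w) ^ (1 : ℝ)) atTop (𝓝 0) := by
    refine tendsto_of_tendsto_of_tendsto_of_le_of_le tendsto_const_nhds ?_ (fun _ => zero_le) hsum
    simpa using ENNReal.tendsto_ofReal hr
  have := Measure.hausdorffMeasure_le_liminf_sum 1 (Set.range g) (l := atTop)
    (fun n => ENNReal.ofReal (r n)) (by simpa using ENNReal.tendsto_ofReal hr') t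
    (Eventually.of_forall hdiam) (Eventually.of_forall hcover)
  rw [hlim.liminf_eq] at this
  exact le_antisymm this zero_le

/-- If sequences of base-`b` digits that first differ at position `n` are coded by points whose
distance is at least of order `b ^ (-n / s)`, then the set of all coded points has Hausdorff
dimension at least `s`, since reading off the digits is an `s`-Hölder map onto an interval. -/
theorem le_dimH_range_of_separated (hb : 1 < b) {s C : ℝ≥0} (hs : 0 < s)
    (hg : ∀ n ω ω', (∀ i < n, ω i = ω' i) → ω n ≠ ω' n →
      ((b : ℝ) ^ n)⁻¹ ≤ C * dist (g ω) (g ω') ^ (s : ℝ)) :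
    (s : ℝ≥0∞) ≤ dimH (Set.range g) := by
  have : NeZero b := ⟨by omega⟩
  let h : ℝ → X := fun x => g (digits x b)
  have hh : ∀ x ∈ Set.Ico (0 : ℝ) 1, ∀ y ∈ Set.Ico (0 : ℝ) 1,
      dist x y ≤ C * dist (h x) (h y) ^ (s : ℝ) := by
    intro x hx y hy
    by_cases hxy : digits x b = digits y b
    · have : x = y := by rw [← ofDigits_digits hb hx, hxy, ofDigits_digits hb hy]
      rw [this, dist_self]
      positivity
    · have hex : ∃ n, digits x b n ≠ digits y b n := Function.ne_iff.1 hxy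
      classical
      have hlt : ∀ i < Nat.find hex, digits x b i = digits y b i := fun i hi =>
        not_not.1 (Nat.find_min hex hi)
      refine le_trans ?_ (hg _ _ _ hlt (Nat.find_spec hex))
      have := abs_ofDigits_sub_ofDigits_le hlt
      rwa [ofDigits_digits hb hx, ofDigits_digits hb hy] at this
  have hinj : Set.InjOn h (Set.Ico 0 1) := by
    intro x hx y hy hxy
    have := hh x hx y hy
    rw [hxy, dist_self, Real.zero_rpow (by exact_mod_cast hs.ne'), mul_zero] at this
    exact dist_le_zero.1 this
  let f := Function.invFunOn h (Set.Ico 0 1)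
  have hf : ∀ x ∈ Set.Ico (0 : ℝ) 1, f (h x) = x := fun x hx => hinj.leftInvOn_invFunOn hx
  have hholder : HolderOnWith C s f (h '' Set.Ico 0 1) := by
    rintro _ ⟨x, hx, rfl⟩ _ ⟨y, hy, rfl⟩
    rw [hf x hx, hf y hy, edist_dist, edist_dist,
      ENNReal.ofReal_rpow_of_nonneg dist_nonneg s.coe_nonneg, ← ENNReal.ofReal_coe_nnreal,
      ← ENNReal.ofReal_mul C.coe_nonneg]
    exact ENNReal.ofReal_le_ofReal (hh x hx y hy)
  have himage : f '' (h '' Set.Ico 0 1) = Set.Ico 0 1 := by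
    rw [Set.image_image]
    exact (Set.image_congr hf).trans (Set.image_id' _)
  have hdim : dimH (Set.Ico (0 : ℝ) 1) = 1 := by
    rw [Real.dimH_of_nonempty_interior (by simp)]
    simp
  have hle := hholder.dimH_image_le hs
  rw [himage, hdim, ENNReal.le_div_iff_mul_le (Or.inl (by simpa using hs.ne')) (Or.inl (by simp)),
    one_mul] at hle
  refine hle.trans (dimH_mono ?_)
  rintro _ ⟨x, -, rfl⟩
  exact ⟨_, rfl⟩

end Coding

section SubsetSum

/-- The sum of the subsequence of `a` selected by `ε`. -/
noncomputable def subsetSum (a : ℕ → ℝ) (ε : ℕ → Bool) : ℝ := ∑' i, if ε i then a i else 0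

variable {a : ℕ → ℝ}

theorem le_mul_pow_of_le_div_four (hq : ∀ i, a (i + 1) ≤ a i / 4) (n k : ℕ) :
    a (k + n) ≤ a n * (1 / 4) ^ k := by
  induction k with
  | zero => simp
  | succ k ih =>
    have := hq (k + n)
    rw [show k + 1 + n = k + n + 1 by ring, pow_succ]
    linarith

theorem summable_of_le_div_four (ha : ∀ i, 0 ≤ a i) (hq : ∀ i, a (i + 1) ≤ a i / 4) :
    Summable a :=
  Summable.of_nonneg_of_le ha (fun k => le_mul_pow_of_le_div_four hq 0 k)
    ((summable_geometric_of_lt_one (by norm_num) (by norm_num)).mul_left _)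

theorem abs_tsum_sub_sum_range_le (ha : ∀ i, 0 ≤ a i) (hq : ∀ i, a (i + 1) ≤ a i / 4)
    {u : ℕ → ℝ} (hu : ∀ i, |u i| ≤ a i) (n : ℕ) :
    |∑' i, u i - ∑ i ∈ Finset.range n, u i| ≤ 4 / 3 * a n := by
  have hsu : Summable u := (summable_of_le_div_four ha hq).of_norm_bounded hu
  rw [← hsu.sum_add_tsum_nat_add n, add_sub_cancel_left]
  have hgeo : HasSum (fun k => a n * (1 / 4 : ℝ) ^ k) (4 / 3 * a n) := by
    have := (hasSum_geometric_of_lt_one (r := (1 / 4 : ℝ)) (by norm_num) (by norm_num)).mul_left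
      (a n)
    rwa [show a n * (1 - 1 / 4 : ℝ)⁻¹ = 4 / 3 * a n by ring] at this
  exact tsum_of_norm_bounded (f := fun k => u (k + n)) hgeo fun k => (hu _).trans (le_mul_pow_of_le_div_four hq n k)

theorem summable_subsetSum (ha : ∀ i, 0 ≤ a i) (hq : ∀ i, a (i + 1) ≤ a i / 4) (ε : ℕ → Bool) :
    Summable fun i => if ε i then a i else 0 := by
  refine Summable.of_nonneg_of_le (fun i => ?_) (fun i => ?_) (summable_of_le_div_four ha hq)
  · split_ifs <;> simp [ha i]
  · split_ifs <;> simp [ha i]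

theorem subsetSum_nonneg (ha : ∀ i, 0 ≤ a i) (ε : ℕ → Bool) : 0 ≤ subsetSum a ε :=
  tsum_nonneg fun i => by split_ifs <;> simp [ha i]

theorem subsetSum_le (ha : ∀ i, 0 ≤ a i) (hq : ∀ i, a (i + 1) ≤ a i / 4) (ε : ℕ → Bool) :
    subsetSum a ε ≤ 4 / 3 * a 0 := by
  have := abs_tsum_sub_sum_range_le ha hq (u := fun i => if ε i then a i else 0)
    (fun i => by split_ifs <;> simp [ha i, abs_of_nonneg]) 0
  simp only [Finset.range_zero, Finset.sum_empty, sub_zero] at this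
  exact (le_abs_self _).trans this

theorem continuous_subsetSum (ha : ∀ i, 0 ≤ a i) (hq : ∀ i, a (i + 1) ≤ a i / 4) :
    Continuous (subsetSum a) := by
  refine continuous_tsum (fun i => ?_) (summable_of_le_div_four ha hq) fun i ε => ?_
  · exact (continuous_of_discreteTopology (f := fun c : Bool => if c then a i else 0)).comp
      (continuous_apply i)
  · split_ifs <;> simp [ha i, abs_of_nonneg]

theorem abs_subsetSum_sub_sub_sum_range_le (ha : ∀ i, 0 ≤ a i)
    (hq : ∀ i, a (i + 1) ≤ a i / 4) (ε δ : ℕ → Bool) (n : ℕ) :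
    |subsetSum a ε - subsetSum a δ -
      ∑ i ∈ Finset.range n, ((if ε i then a i else 0) - (if δ i then a i else 0))| ≤
      4 / 3 * a n := by
  rw [subsetSum, subsetSum,
    ← (summable_subsetSum ha hq ε).tsum_sub (summable_subsetSum ha hq δ)]
  refine abs_tsum_sub_sum_range_le ha hq (fun i => ?_) n
  split_ifs <;> simp [ha i, abs_of_nonneg]

theorem abs_subsetSum_sub_le (ha : ∀ i, 0 ≤ a i) (hq : ∀ i, a (i + 1) ≤ a i / 4)
    {ε δ : ℕ → Bool} {n : ℕ} (h : ∀ i < n, ε i = δ i) :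
    |subsetSum a ε - subsetSum a δ| ≤ 4 / 3 * a n := by
  have := abs_subsetSum_sub_sub_sum_range_le ha hq ε δ n
  rwa [Finset.sum_eq_zero fun i hi => by rw [h i (Finset.mem_range.1 hi), sub_self],
    sub_zero] at this

theorem le_abs_subsetSum_sub (ha : ∀ i, 0 ≤ a i) (hq : ∀ i, a (i + 1) ≤ a i / 4)
    {ε δ : ℕ → Bool} {n : ℕ} (h : ∀ i < n, ε i = δ i) (hn : ε n ≠ δ n) :
    2 / 3 * a n ≤ |subsetSum a ε - subsetSum a δ| := by
  have key := abs_subsetSum_sub_sub_sum_range_le ha hq ε δ (n + 1)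
  rw [Finset.sum_range_succ,
    Finset.sum_eq_zero fun i hi => by rw [h i (Finset.mem_range.1 hi), sub_self],
    zero_add, abs_le] at key
  have hq' := hq n
  rw [le_abs]
  cases hε : ε n <;> cases hδ : δ n <;> simp [hε, hδ] at key hn
  · right; linarith
  · left; linarith

end SubsetSum

/-- Digit sequences in base four code the points of the square of the set of subset sums of `a`. -/
noncomputable def squareCoding (a : ℕ → ℝ) (e : Fin 4 ≃ Bool × Bool) (ω : ℕ → Fin 4) :
    EuclideanSpace ℝ (Fin 2) :=
  !₂[subsetSum a fun i => (e (ω i)).1, subsetSum a fun i => (e (ω i)).2]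

section SquareCoding

variable {a : ℕ → ℝ} {e : Fin 4 ≃ Bool × Bool}

theorem range_squareCoding :
    Set.range (squareCoding a e) =
      {p | p 0 ∈ Set.range (subsetSum a) ∧ p 1 ∈ Set.range (subsetSum a)} := by
  ext p
  constructor
  · rintro ⟨ω, rfl⟩
    exact ⟨⟨_, rfl⟩, ⟨_, rfl⟩⟩
  · rintro ⟨⟨ε, hε⟩, ⟨δ, hδ⟩⟩
    refine ⟨fun i => e.symm (ε i, δ i), ?_⟩
    ext j
    fin_cases j <;> simp [squareCoding, hε, hδ]

theorem dist_squareCoding_le (ha : ∀ i, 0 ≤ a i) (hq : ∀ i, a (i + 1) ≤ a i / 4) {n : ℕ}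
    {ω ω' : ℕ → Fin 4} (h : ∀ i < n, ω i = ω' i) :
    dist (squareCoding a e ω) (squareCoding a e ω') ≤ 8 / 3 * a n := by
  have h1 := abs_subsetSum_sub_le ha hq (ε := fun i => (e (ω i)).1)
    (δ := fun i => (e (ω' i)).1) fun i hi => by rw [h i hi]
  have h2 := abs_subsetSum_sub_le ha hq (ε := fun i => (e (ω i)).2)
    (δ := fun i => (e (ω' i)).2) fun i hi => by rw [h i hi]
  rw [EuclideanSpace.dist_eq, Fin.sum_univ_two]
  simp only [squareCoding, Real.dist_eq]
  refine Real.sqrt_le_iff.2 ⟨by linarith [ha n], ?_⟩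
  have g1 := pow_le_pow_left₀ (abs_nonneg _) h1 2
  have g2 := pow_le_pow_left₀ (abs_nonneg _) h2 2
  simp only [Matrix.cons_val_zero, Matrix.cons_val_one]
  nlinarith [sq_nonneg (a n)]

theorem le_dist_squareCoding (ha : ∀ i, 0 ≤ a i) (hq : ∀ i, a (i + 1) ≤ a i / 4) {n : ℕ}
    {ω ω' : ℕ → Fin 4} (h : ∀ i < n, ω i = ω' i) (hn : ω n ≠ ω' n) :
    2 / 3 * a n ≤ dist (squareCoding a e ω) (squareCoding a e ω') := by
  have hcoord : ∀ j, |squareCoding a e ω j - squareCoding a e ω' j| ≤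
      dist (squareCoding a e ω) (squareCoding a e ω') := by
    intro j
    rw [dist_eq_norm]
    exact PiLp.norm_apply_le (squareCoding a e ω - squareCoding a e ω') j
  by_cases h1 : (e (ω n)).1 = (e (ω' n)).1
  · have h2 : (e (ω n)).2 ≠ (e (ω' n)).2 := fun h2 => hn (e.injective (Prod.ext h1 h2))
    exact (le_abs_subsetSum_sub ha hq (ε := fun i => (e (ω i)).2)
      (δ := fun i => (e (ω' i)).2) (fun i hi => by rw [h i hi]) h2).trans (hcoord 1)
  · exact (le_abs_subsetSum_sub ha hq (ε := fun i => (e (ω i)).1)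
      (δ := fun i => (e (ω' i)).1) (fun i hi => by rw [h i hi]) h1).trans (hcoord 0)

end SquareCoding

/-- Dividing `4⁻ⁿ` by a linear factor does not change its exponential rate of decay. -/
theorem exists_inv_four_pow_le_mul_rpow {s : ℝ≥0} (hs : s < 1) :
    ∃ C : ℝ≥0, ∀ n : ℕ,
      ((4 : ℝ) ^ n)⁻¹ ≤ C * (2 / 3 * (((4 : ℝ) ^ n)⁻¹ / (n + 2))) ^ (s : ℝ) := by
  have hs' : (s : ℝ) < 1 := by exact_mod_cast hs
  set q : ℝ := (4 : ℝ) ^ (s - 1 : ℝ) with hq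
  have hq0 : 0 < q := by positivity
  have hq1 : q < 1 := Real.rpow_lt_one_of_one_lt_of_neg (by norm_num) (by linarith)
  have hlim : Tendsto (fun n : ℕ => 3 / 2 * ((n + 2 : ℝ) * q ^ n)) atTop
      (𝓝 (3 / 2 * (0 + 2 * 0))) := by
    simp only [add_mul]
    exact ((tendsto_self_mul_const_pow_of_lt_one hq0.le hq1).add
      ((tendsto_pow_atTop_nhds_zero_of_lt_one hq0.le hq1).const_mul 2)).const_mul _
  obtain ⟨C, hC⟩ := hlim.bddAbove_range
  have hC' : ∀ n : ℕ, 3 / 2 * ((n + 2 : ℝ) * q ^ n) ≤ C := fun n => hC ⟨n, rfl⟩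
  have hC0 : 0 ≤ C := le_trans (by positivity) (hC' 0)
  refine ⟨⟨C, hC0⟩, fun n => ?_⟩
  have hfac : 2 / 3 / (n + 2 : ℝ) ≤ (2 / 3 / (n + 2 : ℝ)) ^ (s : ℝ) := by
    refine Real.self_le_rpow_of_le_one (by positivity) ?_ hs'.le
    rw [div_le_one (by positivity)]
    linarith [(Nat.cast_nonneg n : (0 : ℝ) ≤ n)]
  have hpow : ((4 : ℝ) ^ n)⁻¹ = q ^ n * (((4 : ℝ) ^ n)⁻¹) ^ (s : ℝ) := by
    rw [hq, Real.inv_rpow (by positivity), ← Real.rpow_natCast, ← Real.rpow_natCast,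
      ← Real.rpow_mul (by norm_num), ← Real.rpow_mul (by norm_num), ← Real.rpow_neg (by norm_num),
      ← Real.rpow_neg (by norm_num), ← Real.rpow_add (by norm_num)]
    congr 1
    ring
  have hsplit : (2 / 3 * (((4 : ℝ) ^ n)⁻¹ / (n + 2))) ^ (s : ℝ) =
      (2 / 3 / (n + 2 : ℝ)) ^ (s : ℝ) * (((4 : ℝ) ^ n)⁻¹) ^ (s : ℝ) := by
    rw [← Real.mul_rpow (by positivity) (by positivity)]
    congr 1
    ring
  rw [hsplit, ← mul_assoc]
  conv_lhs => rw [hpow]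
  refine mul_le_mul_of_nonneg_right ?_ (by positivity)
  calc q ^ n = 3 / 2 * ((n + 2 : ℝ) * q ^ n) * (2 / 3 / (n + 2 : ℝ)) := by field_simp
    _ ≤ C * (2 / 3 / (n + 2 : ℝ)) ^ (s : ℝ) := mul_le_mul (hC' n) hfac (by positivity) hC0

/-- There exists a nonempty compact set `C ⊆ [0,1]` such that
`K = C × C ⊆ ℝ²` (with the Euclidean metric) has Hausdorff dimension `1` but vanishing
`1`-dimensional Hausdorff measure. -/
theorem exists_cantor_square_dimH_one_measure_zero :
    ∃ C : Set ℝ, C ⊆ Set.Icc 0 1 ∧ C.Nonempty ∧ IsCompact C ∧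
      dimH ({p : EuclideanSpace ℝ (Fin 2) | p 0 ∈ C ∧ p 1 ∈ C}) = 1 ∧
      μH[1] ({p : EuclideanSpace ℝ (Fin 2) | p 0 ∈ C ∧ p 1 ∈ C}) = 0 := by
  let a : ℕ → ℝ := fun n => ((4 : ℝ) ^ n)⁻¹ / (n + 2)
  have ha : ∀ n, 0 ≤ a n := fun n => by positivity
  have hq : ∀ n, a (n + 1) ≤ a n / 4 := by
    intro n
    calc a (n + 1) = ((4 : ℝ) ^ n)⁻¹ / 4 / (n + 3) := by
          simp only [a]
          rw [pow_succ]
          push_cast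
          field_simp
          ring
      _ ≤ ((4 : ℝ) ^ n)⁻¹ / 4 / (n + 2) := by gcongr; norm_num
      _ = a n / 4 := by simp only [a]; ring
  let e : Fin 4 ≃ Bool × Bool := Fintype.equivOfCardEq (by simp)
  have hzero : μH[1] (Set.range (squareCoding a e)) = 0 := by
    refine hausdorffMeasure_one_range_eq_zero (by norm_num)
      (fun n ω ω' h => dist_squareCoding_le ha hq h) ?_
    have : Tendsto (fun n : ℕ => 8 / 3 / ((n : ℝ) + 2)) atTop (𝓝 0) :=
      tendsto_const_nhds.div_atTop
        (tendsto_atTop_add_const_right _ _ tendsto_natCast_atTop_atTop)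
    refine this.congr fun n => ?_
    simp only [a]
    push_cast
    field_simp
  refine ⟨Set.range (subsetSum a), ?_, Set.range_nonempty _,
    isCompact_range (continuous_subsetSum ha hq), ?_, ?_⟩
  · rintro _ ⟨ε, rfl⟩
    refine ⟨subsetSum_nonneg ha ε, (subsetSum_le ha hq ε).trans ?_⟩
    norm_num [a]
  · rw [← range_squareCoding (e := e)]
    refine le_antisymm ?_ (ENNReal.le_of_forall_nnreal_lt fun s hs => ?_)
    · refine dimH_le_of_hausdorffMeasure_ne_top (d := 1) ?_
      simp [hzero]
    · rcases eq_or_ne s 0 with rfl | hs0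
      · simp
      obtain ⟨C, hC⟩ := exists_inv_four_pow_le_mul_rpow (by exact_mod_cast hs : s < 1)
      refine le_dimH_range_of_separated (C := C) (by norm_num) (pos_iff_ne_zero.2 hs0)
        fun n ω ω' h hn => (hC n).trans ?_
      refine mul_le_mul_of_nonneg_left ?_ C.coe_nonneg
      exact Real.rpow_le_rpow (by positivity) (le_dist_squareCoding ha hq h hn) s.coe_nonneg
  · rw [← range_squareCoding (e := e)]
    exact hzero
end
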